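/- Let X and Y be S-cofibrant flows, with skeletal filtrations (X¹ₙ)ₙ and (Y¹ₙ)ₙ, and let f : X → Y be a morphism of flows. Then f is S-homotopic to a morphism of flows g : X → Y which is cellular, i.e. such that g(X¹ₙ) ⊆ Y¹ₙ for every n ≥ 0. -/

import Mathlib

open CategoryTheory

namespace Gaucher

/-- Helper: any map out of an empty space is continuous. -/
theorem continuous_of_isEmpty {α β : Type*} [TopologicalSpace α] [TopologicalSpace β]
    [IsEmpty α] (f : α → β) : Continuous f :=
  ⟨fun s _ => by rw [Set.eq_empty_of_isEmpty (f ⁻¹' s)]; exact isOpen_empty⟩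

/-- Helper: fibers of constant maps are open. -/
theorem isOpen_preimage_const {α β : Type*} [TopologicalSpace α] (b a : β) :
    IsOpen ((fun _ : α => b) ⁻¹' {a}) := by
  rcases eq_or_ne b a with h | h
  · rw [Set.preimage_const_of_mem (by simpa using h)]; exact isOpen_univ
  · rw [Set.preimage_const_of_notMem (by simpa using h)]; exact isOpen_empty

/-- A flow (Gaucher): a set of states (with the discrete topology), a topological
space of (non-constant) execution paths, source and target maps which are continuous
(i.e. have open fibers, the state set being discrete), and a continuous, associative
partial composition defined on composable pairs of paths. -/
structure Flow : Type 1 where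
  /-- the `0`-skeleton, i.e. the set of states -/
  State : Type
  /-- the space of non-constant execution paths -/
  Path : Type
  [topPath : TopologicalSpace Path]
  /-- source map -/
  s : Path → State
  /-- target map -/
  t : Path → State
  isOpen_preimage_s : ∀ a : State, IsOpen (s ⁻¹' {a})
  isOpen_preimage_t : ∀ a : State, IsOpen (t ⁻¹' {a})
  /-- composition of composable paths -/
  comp : ∀ x y : Path, t x = s y → Path
  continuous_comp : Continuous (fun p : { p : Path × Path // t p.1 = s p.2 } =>
    comp p.1.1 p.1.2 p.2)
  s_comp : ∀ x y h, s (comp x y h) = s x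
  t_comp : ∀ x y h, t (comp x y h) = t y
  comp_assoc : ∀ (x y z : Path) (hxy : t x = s y) (hyz : t y = s z)
    (h₁ : t x = s (comp y z hyz)) (h₂ : t (comp x y hxy) = s z),
    comp x (comp y z hyz) h₁ = comp (comp x y hxy) z h₂

attribute [instance] Flow.topPath

/-- The state set of a flow carries the discrete topology. -/
instance Flow.topState (X : Flow) : TopologicalSpace X.State := ⊥

instance (X : Flow) : DiscreteTopology X.State := ⟨rfl⟩

/-- A morphism of flows: a map preserving states, paths, sources, targets and
composition, continuous on the path spaces (continuity on the discrete state part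
being automatic). -/
structure FlowHom (X Y : Flow) : Type where
  toFun0 : X.State → Y.State
  toFunP : X.Path → Y.Path
  continuous_toFunP : Continuous toFunP
  s_map : ∀ x, Y.s (toFunP x) = toFun0 (X.s x)
  t_map : ∀ x, Y.t (toFunP x) = toFun0 (X.t x)
  comp_map : ∀ x y (h : X.t x = X.s y) (h' : Y.t (toFunP x) = Y.s (toFunP y)),
    toFunP (X.comp x y h) = Y.comp (toFunP x) (toFunP y) h'

theorem FlowHom.ext {X Y : Flow} {f g : FlowHom X Y}
    (h0 : f.toFun0 = g.toFun0) (hP : f.toFunP = g.toFunP) : f = g := by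
  cases f; cases g; cases h0; cases hP; rfl

/-- The identity morphism of flows. -/
def FlowHom.id (X : Flow) : FlowHom X X where
  toFun0 := _root_.id
  toFunP := _root_.id
  continuous_toFunP := continuous_id
  s_map _ := rfl
  t_map _ := rfl
  comp_map _ _ _ _ := rfl

/-- Composition of morphisms of flows (`g.comp f` is `g ∘ f`). -/
def FlowHom.comp {X Y Z : Flow} (g : FlowHom Y Z) (f : FlowHom X Y) : FlowHom X Z where
  toFun0 := g.toFun0 ∘ f.toFun0
  toFunP := g.toFunP ∘ f.toFunP
  continuous_toFunP := g.continuous_toFunP.comp f.continuous_toFunP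
  s_map x := by simp only [Function.comp_apply, g.s_map, f.s_map]
  t_map x := by simp only [Function.comp_apply, g.t_map, f.t_map]
  comp_map x y h h' := by
    have hY : Y.t (f.toFunP x) = Y.s (f.toFunP y) := by
      rw [f.t_map, f.s_map, h]
    show g.toFunP (f.toFunP (X.comp x y h)) = _
    rw [f.comp_map x y h hY, g.comp_map _ _ hY h']
    rfl

/-- The category `Flow` of flows. -/
instance : Category Flow where
  Hom := FlowHom
  id := FlowHom.id
  comp f g := g.comp f
  id_comp f := FlowHom.ext rfl rfl
  comp_id f := FlowHom.ext rfl rfl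
  assoc f g h := FlowHom.ext rfl rfl

theorem FlowHom.comp_assoc {W X Y Z : Flow} (h : FlowHom Y Z) (g : FlowHom X Y)
    (f : FlowHom W X) : (h.comp g).comp f = h.comp (g.comp f) :=
  FlowHom.ext rfl rfl

/-- The flow `Glob Z` associated to a topological space `Z`: two states `0` and `1`,
path space `Z`, every path going from `0` to `1` (no two paths are composable). -/
def Glob (Z : Type) [TopologicalSpace Z] : Flow where
  State := Fin 2
  Path := Z
  s := fun _ => 0
  t := fun _ => 1
  isOpen_preimage_s := fun a => isOpen_preimage_const _ a
  isOpen_preimage_t := fun a => isOpen_preimage_const _ a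
  comp := fun _ _ h => absurd (show (1 : Fin 2) = 0 from h) (by decide)
  continuous_comp := by
    haveI : IsEmpty { p : Z × Z // (fun _ : Z => (1 : Fin 2)) p.1 = (fun _ : Z => (0 : Fin 2)) p.2 } :=
      ⟨fun p => absurd (show (1 : Fin 2) = 0 from p.2) (by decide)⟩
    exact continuous_of_isEmpty _
  s_comp := fun x y h => absurd (show (1 : Fin 2) = 0 from h) (by decide)
  t_comp := fun x y h => absurd (show (1 : Fin 2) = 0 from h) (by decide)
  comp_assoc := fun x y z hxy => absurd (show (1 : Fin 2) = 0 from hxy) (by decide)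

/-- Functoriality of `Glob`. -/
def Glob.map {Z W : Type} [TopologicalSpace Z] [TopologicalSpace W] (f : C(Z, W)) :
    FlowHom (Glob Z) (Glob W) where
  toFun0 := _root_.id
  toFunP := f
  continuous_toFunP := f.continuous
  s_map _ := rfl
  t_map _ := rfl
  comp_map x y h := absurd (show (1 : Fin 2) = 0 from h) (by decide)

/-- The directed segment `I⃗` is `Glob` of a one-point space. -/
def dirSegment : Flow := Glob PUnit

/-- The flow with exactly one state and no non-constant execution path. -/
def pointFlow : Flow where
  State := PUnit
  Path := Empty
  s := fun e => e.elim
  t := fun e => e.elim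
  isOpen_preimage_s := fun a => by
    rw [Set.eq_empty_of_isEmpty (_ ⁻¹' {a})]; exact isOpen_empty
  isOpen_preimage_t := fun a => by
    rw [Set.eq_empty_of_isEmpty (_ ⁻¹' {a})]; exact isOpen_empty
  comp := fun x _ _ => x.elim
  continuous_comp := continuous_of_isEmpty _
  s_comp := fun x => x.elim
  t_comp := fun x => x.elim
  comp_assoc := fun x => x.elim

-- PART B (appended after part A) : S-homotopy, weak homotopy equivalences

/-- Two morphisms of flows `f g : X → Y` are S-homotopic: there is a continuous map
`H : (X⁰ ⊔ ℙX) × [0,1] → Y⁰ ⊔ ℙY` such that every `H(-,u)` is a morphism of flows,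
`H(-,0) = f` and `H(-,1) = g`.  (Continuity of `H` on the two summands `ℙX × [0,1]`
and `X⁰ × [0,1]` — the state sets carrying the discrete topology — is exactly
continuity of the two maps below.) -/
def SHomotopy {X Y : Flow} (f g : FlowHom X Y) : Prop :=
  ∃ F : unitInterval → FlowHom X Y,
    F 0 = f ∧ F 1 = g ∧
    Continuous (fun p : X.Path × unitInterval => (F p.2).toFunP p.1) ∧
    Continuous (fun p : X.State × unitInterval => (F p.2).toFun0 p.1)

/-- A morphism of flows is an S-homotopy equivalence if it admits an inverse up to
S-homotopy. -/
def IsSHomotopyEquiv {X Y : Flow} (f : FlowHom X Y) : Prop :=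
  ∃ g : FlowHom Y X, SHomotopy (f.comp g) (FlowHom.id Y) ∧ SHomotopy (g.comp f) (FlowHom.id X)

/-- Two flows are S-homotopy equivalent. -/
def SHomotopyEquivalent (X Y : Flow) : Prop :=
  ∃ f : FlowHom X Y, IsSHomotopyEquiv f

/-- The underlying continuous map on path spaces of a morphism of flows. -/
def FlowHom.pathMap {X Y : Flow} (f : FlowHom X Y) : C(X.Path, Y.Path) :=
  ⟨f.toFunP, f.continuous_toFunP⟩

/-- The map induced by a continuous map on `π₀` (path components). -/
def pi0Map {A B : Type*} [TopologicalSpace A] [TopologicalSpace B] (h : C(A, B)) :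
    ZerothHomotopy A → ZerothHomotopy B :=
  Quotient.map h (fun _ _ j => ⟨j.somePath.map h.continuous⟩)

/-- Push forward a generalized loop along a continuous map. -/
def GenLoop.push {A B : Type*} [TopologicalSpace A] [TopologicalSpace B] (h : C(A, B))
    {N : Type*} {x : A} (p : GenLoop N A x) : GenLoop N B (h x) :=
  ⟨h.comp p.1, fun y hy => by
    simp only [ContinuousMap.comp_apply]
    exact congrArg h (p.2 y hy)⟩

/-- The map induced by a continuous map on the `N`-th homotopy group. -/
def piMap {A B : Type*} [TopologicalSpace A] [TopologicalSpace B] (h : C(A, B))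
    (N : Type*) (x : A) : HomotopyGroup N A x → HomotopyGroup N B (h x) :=
  Quotient.map (GenLoop.push h) (fun _ _ H =>
    ⟨(Nonempty.some H).compContinuousMap h⟩)

/-- A continuous map is a weak homotopy equivalence: it induces a bijection on path
components and, for every base point and every `n`, a bijection on `πₙ`. -/
def IsWeakHomotopyEquiv {A B : Type*} [TopologicalSpace A] [TopologicalSpace B]
    (h : C(A, B)) : Prop :=
  Function.Bijective (pi0Map h) ∧
    ∀ (x : A) (n : ℕ), Function.Bijective (piMap h (Fin n) x)

/-- A morphism of flows is a weak S-homotopy equivalence if it induces a bijection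
on the `0`-skeletons and a weak homotopy equivalence on the path spaces. -/
def IsWeakSHomotopyEquiv {X Y : Flow} (f : FlowHom X Y) : Prop :=
  Function.Bijective f.toFun0 ∧ IsWeakHomotopyEquiv f.pathMap

-- PART C : S-cofibrant flows

/-- The sphere `S^{n-1}`, boundary of the closed `n`-disk `D^n`. -/
abbrev diskBoundary (n : ℕ) : Type := Metric.sphere (0 : EuclideanSpace ℝ (Fin n)) 1

/-- The closed `n`-disk `D^n`. -/
abbrev closedDisk (n : ℕ) : Type := Metric.closedBall (0 : EuclideanSpace ℝ (Fin n)) 1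

/-- The inclusion `S^{n-1} ⊆ D^n`. -/
noncomputable def diskBoundaryInclusion (n : ℕ) : C(diskBoundary n, closedDisk n) :=
  ⟨fun p => ⟨p.1, Metric.sphere_subset_closedBall p.2⟩,
    Continuous.subtype_mk continuous_subtype_val _⟩

/-- The inclusion of flows `Glob (S^{n-1}) → Glob (D^n)`. -/
noncomputable def globBoundaryInclusion (n : ℕ) : FlowHom (Glob (diskBoundary n)) (Glob (closedDisk n)) :=
  Glob.map (diskBoundaryInclusion n)

/-- A witness that a flow `X` is S-cofibrant: a skeletal filtration `sk 0 → sk 1 → ⋯`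
where `sk 0` has empty path space (it is purely a discrete set of states), where
`sk (n+1)` is obtained from `sk n` as the pushout (expressed by its universal property,
`attach_isPushout`) of `⊔ᵢ Glob (S^{n-1}) → ⊔ᵢ Glob (D^n)` along attaching morphisms
`Glob (S^{n-1}) → sk n` (for `n = 0` this attaches copies of the directed segment
`I⃗ = Glob(D⁰)` along `Glob(S^{-1}) = Glob(∅)`), and where `X` is the colimit
(expressed by its universal property `isColimit`) of the `sk n`. -/
structure SCofibrantStructure (X : Flow) : Type 1 where
  sk : ℕ → Flow
  isEmpty_path_sk_zero : IsEmpty (sk 0).Path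
  ι : ∀ n, FlowHom (sk n) (sk (n + 1))
  cells : ℕ → Type
  attachMap : ∀ n, cells n → FlowHom (Glob (diskBoundary n)) (sk n)
  cellMap : ∀ n, cells n → FlowHom (Glob (closedDisk n)) (sk (n + 1))
  attach_comm : ∀ n (i : cells n),
    (cellMap n i).comp (globBoundaryInclusion n) = (ι n).comp (attachMap n i)
  attach_isPushout : ∀ n (Z : Flow) (g : FlowHom (sk n) Z)
    (k : cells n → FlowHom (Glob (closedDisk n)) Z),
    (∀ i, (k i).comp (globBoundaryInclusion n) = g.comp (attachMap n i)) →
    ∃! h : FlowHom (sk (n + 1)) Z, h.comp (ι n) = g ∧ ∀ i, h.comp (cellMap n i) = k i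
  incl : ∀ n, FlowHom (sk n) X
  incl_comm : ∀ n, (incl (n + 1)).comp (ι n) = incl n
  isColimit : ∀ (Z : Flow) (d : ∀ n, FlowHom (sk n) Z),
    (∀ n, (d (n + 1)).comp (ι n) = d n) →
    ∃! h : FlowHom X Z, ∀ n, h.comp (incl n) = d n

/-- A flow is S-cofibrant if it admits a skeletal filtration as above. -/
def SCofibrant (X : Flow) : Prop :=
  Nonempty (SCofibrantStructure X)

-- PART D : the flow U ⊠ X, S-cofibrations, NDR pairs, the space FLOW(X,Y)

/-- The data exhibiting a flow `B` as a candidate for `U ⊠ X` (`U` a topological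
space, `X` a flow): the generators, i.e. the states of `X` and a continuous family
`η (u, x)` of paths indexed by `U × ℙX`, subject to the defining relations
`s(u ⊠ x) = s x`, `t(u ⊠ x) = t x` and `(u ⊠ x) * (u ⊠ y) = u ⊠ (x * y)`. -/
structure BoxCocone (U : Type) [TopologicalSpace U] (X B : Flow) : Type where
  η0 : X.State → B.State
  η : U × X.Path → B.Path
  continuous_η : Continuous η
  s_η : ∀ u x, B.s (η (u, x)) = η0 (X.s x)
  t_η : ∀ u x, B.t (η (u, x)) = η0 (X.t x)
  comp_η : ∀ u x y (h : X.t x = X.s y) (h' : B.t (η (u, x)) = B.s (η (u, y))),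
    B.comp (η (u, x)) (η (u, y)) h' = η (u, X.comp x y h)

/-- `B`, equipped with the data `c`, *is* the flow `U ⊠ X`, i.e. the free flow
generated by `X⁰ ⊔ (U × ℙX)` quotiented by the relations `s (u,x) = s x`,
`t (u,x) = t x` and `(u,x) * (u,y) = (u, x*y)`: every flow `Z` equipped with such
data receives a unique morphism of flows from `B` compatible with the data. -/
def IsBoxTimes {U : Type} [TopologicalSpace U] {X B : Flow} (c : BoxCocone U X B) : Prop :=
  ∀ (Z : Flow) (d : BoxCocone U X Z),
    ∃! f : FlowHom B Z, f.toFun0 ∘ c.η0 = d.η0 ∧ f.toFunP ∘ c.η = d.η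

/-- For `u ∈ U`, the morphism of flows `X → U ⊠ X`, `x ↦ u ⊠ x`. -/
def BoxCocone.atTime {U : Type} [TopologicalSpace U] {X B : Flow}
    (c : BoxCocone U X B) (u : U) : FlowHom X B where
  toFun0 := c.η0
  toFunP := fun x => c.η (u, x)
  continuous_toFunP := c.continuous_η.comp (Continuous.prodMk_right u)
  s_map x := c.s_η u x
  t_map x := c.t_η u x
  comp_map x y h h' := (c.comp_η u x y h h').symm

/-- Given box-product data `c : BoxCocone U A BUA` and `c' : BoxCocone V X BVX`, a
continuous map `φ : U → V` and a morphism of flows `f : A → X`, this asserts that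
`m : BUA → BVX` is the canonically induced morphism `φ ⊠ f`, i.e. `u ⊠ a ↦ φ u ⊠ f a`. -/
def IsInducedBoxHom {U V : Type} [TopologicalSpace U] [TopologicalSpace V]
    {A X BUA BVX : Flow} (c : BoxCocone U A BUA) (c' : BoxCocone V X BVX)
    (φ : U → V) (f : FlowHom A X) (m : FlowHom BUA BVX) : Prop :=
  (∀ a, m.toFun0 (c.η0 a) = c'.η0 (f.toFun0 a)) ∧
  (∀ u x, m.toFunP (c.η (u, x)) = c'.η (φ u, f.toFunP x))

/-- A morphism of flows `i : A → X` is an S-cofibration if it satisfies the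
S-homotopy extension property: for every realization of `[0,1] ⊠ A` and `[0,1] ⊠ X`,
every morphism `g : X → Z` and every S-homotopy `H : [0,1] ⊠ A → Z` starting at
`g ∘ i`, there is an S-homotopy `H̄ : [0,1] ⊠ X → Z` with `H̄(u ⊠ i x) = H(u ⊠ x)`
and `H̄(0 ⊠ y) = g y`. -/
def IsSCofibration {A X : Flow} (i : FlowHom A X) : Prop :=
  ∀ (IA IX : Flow) (cA : BoxCocone unitInterval A IA) (cX : BoxCocone unitInterval X IX),
    IsBoxTimes cA → IsBoxTimes cX →
    ∀ (Z : Flow) (g : FlowHom X Z) (H : FlowHom IA Z),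
      H.comp (cA.atTime 0) = g.comp i →
      ∃ Hbar : FlowHom IX Z,
        (∀ u : unitInterval, (Hbar.comp ((cX.atTime u).comp i)) = H.comp (cA.atTime u)) ∧
        Hbar.comp (cX.atTime 0) = g

/-- `(Y, B)` is an NDR pair: `B` is closed in `Y` and there are `u : Y → [0,1]` with
`B = u⁻¹(0)` and a homotopy `h : Y × [0,1] → Y` with `h(y,0) = y`, `h(b,t) = b` for
`b ∈ B`, and `h(y,1) ∈ B` as soon as `u y < 1`. -/
def IsNDRPair {Y : Type} [TopologicalSpace Y] (B : Set Y) : Prop :=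
  IsClosed B ∧ ∃ (u : C(Y, unitInterval)) (h : C(Y × unitInterval, Y)),
    B = {y | u y = 0} ∧
    (∀ y, h (y, 0) = y) ∧
    (∀ b ∈ B, ∀ t, h (b, t) = b) ∧
    (∀ y, (u y : ℝ) < 1 → h (y, 1) ∈ B)

/-- `(Y, B)` is a DR pair: as for an NDR pair, but with `u y < 1` everywhere, so that
`B` is a deformation retract of `Y`. -/
def IsDRPair {Y : Type} [TopologicalSpace Y] (B : Set Y) : Prop :=
  IsClosed B ∧ ∃ (u : C(Y, unitInterval)) (h : C(Y × unitInterval, Y)),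
    B = {y | u y = 0} ∧
    (∀ y, h (y, 0) = y) ∧
    (∀ b ∈ B, ∀ t, h (b, t) = b) ∧
    (∀ y, (u y : ℝ) < 1 → h (y, 1) ∈ B) ∧
    (∀ y, (u y : ℝ) < 1)

/-- A morphism of flows, as a continuous map `X⁰ ⊔ ℙX → Y⁰ ⊔ ℙY`. -/
def FlowHom.toSumMap {X Y : Flow} (f : FlowHom X Y) :
    C(X.State ⊕ X.Path, Y.State ⊕ Y.Path) :=
  ⟨Sum.map f.toFun0 f.toFunP,
    (continuous_of_discreteTopology (α := X.State)).sumMap f.continuous_toFunP⟩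

/-- The set of morphisms of flows from `X` to `Y` carries the topology induced, via
`FlowHom.toSumMap`, by the compact-open topology. -/
def flowHomInducedTop (X Y : Flow) : TopologicalSpace (FlowHom X Y) :=
  TopologicalSpace.induced FlowHom.toSumMap ContinuousMap.compactOpen

/-- The space `FLOW(X,Y)`: morphisms of flows with the Kelleyfication of the induced
compact-open topology. -/
instance FlowHom.topologicalSpace (X Y : Flow) : TopologicalSpace (FlowHom X Y) :=
  @TopologicalSpace.compactlyGenerated.{0} (FlowHom X Y) (flowHomInducedTop X Y)

-- PART E : model structures, localization, limits machinery

/-- The class of weak S-homotopy equivalences, as a class of morphisms of the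
category `Flow`. -/
def weakSHomotopyEquivalences : MorphismProperty Flow :=
  fun _ _ f => IsWeakSHomotopyEquiv f

/-- `f` is a retract of `g` in the arrow category. -/
def IsRetractOfHom {C : Type*} [Category C] {X Y Z W : C} (f : X ⟶ Y) (g : Z ⟶ W) : Prop :=
  ∃ (i : X ⟶ Z) (r : Z ⟶ X) (i' : Y ⟶ W) (r' : W ⟶ Y),
    i ≫ r = 𝟙 X ∧ i' ≫ r' = 𝟙 Y ∧ i ≫ g = f ≫ i' ∧ g ≫ r' = r ≫ f

/-- A model category structure (Quillen) on a category `C`: three classes of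
morphisms — weak equivalences, cofibrations and fibrations — satisfying
two-out-of-three, stability under retracts, the lifting axioms and the
factorization axioms. -/
structure ModelStructure (C : Type*) [Category C] where
  weq : MorphismProperty C
  cof : MorphismProperty C
  fib : MorphismProperty C
  weq_two_out_of_three : weq.HasTwoOutOfThreeProperty
  weq_retract : ∀ {X Y Z W : C} (f : X ⟶ Y) (g : Z ⟶ W),
    IsRetractOfHom f g → weq g → weq f
  cof_retract : ∀ {X Y Z W : C} (f : X ⟶ Y) (g : Z ⟶ W),
    IsRetractOfHom f g → cof g → cof f
  fib_retract : ∀ {X Y Z W : C} (f : X ⟶ Y) (g : Z ⟶ W),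
    IsRetractOfHom f g → fib g → fib f
  lift_cof_trivFib : ∀ {A B P Q : C} (i : A ⟶ B) (p : P ⟶ Q),
    cof i → fib p → weq p → HasLiftingProperty i p
  lift_trivCof_fib : ∀ {A B P Q : C} (i : A ⟶ B) (p : P ⟶ Q),
    cof i → weq i → fib p → HasLiftingProperty i p
  fact_cof_trivFib : ∀ {X Y : C} (f : X ⟶ Y),
    ∃ (Z : C) (i : X ⟶ Z) (p : Z ⟶ Y), cof i ∧ fib p ∧ weq p ∧ i ≫ p = f
  fact_trivCof_fib : ∀ {X Y : C} (f : X ⟶ Y),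
    ∃ (Z : C) (i : X ⟶ Z) (p : Z ⟶ Y), cof i ∧ weq i ∧ fib p ∧ i ≫ p = f

/-- The S-homotopy relation, as a relation on the morphisms of the full subcategory
of S-cofibrant flows. -/
def sHomotopyHomRel : HomRel (ObjectProperty.FullSubcategory SCofibrant) :=
  fun {_ _} f g => SHomotopy f.hom g.hom

/-- The canonical map `FLOW(X, lim Yⱼ) → lim FLOW(X, Yⱼ)`, the target being realized
as the subspace of the product `Π j, FLOW(X, Yⱼ)` consisting of the compatible
families. -/
def canonicalMapToLimit (X : Flow) {J : Type} [SmallCategory J] (D : J ⥤ Flow)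
    (c : Limits.Cone D) :
    FlowHom X c.pt →
      {p : ∀ j, FlowHom X (D.obj j) // ∀ ⦃j j' : J⦄ (φ : j ⟶ j'),
        (D.map φ).comp (p j) = p j'} :=
  fun g => ⟨fun j => (c.π.app j).comp g, by
    intro j j' φ
    have h := c.π.naturality φ
    have h2 : FlowHom.comp (D.map φ) (c.π.app j) = c.π.app j' := by
      have h3 := h.symm.trans
        (show ((Functor.const J).obj c.pt).map φ ≫ c.π.app j' = c.π.app j' from
          FlowHom.ext rfl rfl)
      exact h3
    show FlowHom.comp (D.map φ) (FlowHom.comp (c.π.app j) g) = FlowHom.comp (c.π.app j') g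
    rw [← FlowHom.comp_assoc, h2]⟩


/-! ### Elementary lemmas on morphisms and sub-flows -/

theorem FlowHom.congrP {X Y : Flow} {f g : FlowHom X Y} (h : f = g) (x : X.Path) :
    f.toFunP x = g.toFunP x := by rw [h]

theorem FlowHom.congr0 {X Y : Flow} {f g : FlowHom X Y} (h : f = g) (x : X.State) :
    f.toFun0 x = g.toFun0 x := by rw [h]

/-- Images of composable paths are composable. -/
theorem FlowHom.composable {X Y : Flow} (f : FlowHom X Y) {x y : X.Path} (h : X.t x = X.s y) :
    Y.t (f.toFunP x) = Y.s (f.toFunP y) := by rw [f.t_map, f.s_map, h]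

theorem Flow.continuous_s (X : Flow) : Continuous X.s := by
  rw [continuous_discrete_rng]; exact X.isOpen_preimage_s

theorem Flow.continuous_t (X : Flow) : Continuous X.t := by
  rw [continuous_discrete_rng]; exact X.isOpen_preimage_t

theorem Flow.comp_congr (X : Flow) {x x' y y' : X.Path} (hx : x = x') (hy : y = y')
    (h : X.t x = X.s y) (h' : X.t x' = X.s y') : X.comp x y h = X.comp x' y' h' := by
  subst hx hy; rfl

/-- The sub-flow on all states and a set of paths closed under composition. -/
def subFlow (X : Flow) (S : Set X.Path)
    (hS : ∀ x ∈ S, ∀ y ∈ S, ∀ h : X.t x = X.s y, X.comp x y h ∈ S) : Flow where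
  State := X.State
  Path := S
  s x := X.s x
  t x := X.t x
  isOpen_preimage_s a := (X.isOpen_preimage_s a).preimage continuous_subtype_val
  isOpen_preimage_t a := (X.isOpen_preimage_t a).preimage continuous_subtype_val
  comp x y h := ⟨X.comp x y h, hS _ x.2 _ y.2 h⟩
  continuous_comp := by
    refine Continuous.subtype_mk ?_ _
    exact X.continuous_comp.comp (f := fun p : {p : S × S // X.t p.1 = X.s p.2} =>
      (⟨(p.1.1, p.1.2), p.2⟩ : {p : X.Path × X.Path // X.t p.1 = X.s p.2})) (by fun_prop)
  s_comp x y h := X.s_comp _ _ _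
  t_comp x y h := X.t_comp _ _ _
  comp_assoc x y z hxy hyz h₁ h₂ := Subtype.ext (X.comp_assoc _ _ _ _ _ _ _)

/-- The inclusion of a sub-flow. -/
def subFlowIncl (X : Flow) (S : Set X.Path)
    (hS : ∀ x ∈ S, ∀ y ∈ S, ∀ h : X.t x = X.s y, X.comp x y h ∈ S) :
    FlowHom (subFlow X S hS) X where
  toFun0 := _root_.id
  toFunP x := x.1
  continuous_toFunP := continuous_subtype_val
  s_map _ := rfl
  t_map _ := rfl
  comp_map _ _ _ _ := rfl

/-- Lifting a morphism to a sub-flow. -/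
def subFlowLift {W X : Flow} (S : Set X.Path)
    (hS : ∀ x ∈ S, ∀ y ∈ S, ∀ h : X.t x = X.s y, X.comp x y h ∈ S)
    (f : FlowHom W X) (hf : ∀ x, f.toFunP x ∈ S) : FlowHom W (subFlow X S hS) where
  toFun0 := f.toFun0
  toFunP x := ⟨f.toFunP x, hf x⟩
  continuous_toFunP := f.continuous_toFunP.subtype_mk _
  s_map x := f.s_map x
  t_map x := f.t_map x
  comp_map x y h h' := Subtype.ext (f.comp_map x y h h')

def globHom {D : Type} [TopologicalSpace D] {Z : Flow} (α β : Z.State) (q : D → Z.Path)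
    (hq : Continuous q) (hs : ∀ x, Z.s (q x) = α) (ht : ∀ x, Z.t (q x) = β) :
    FlowHom (Glob D) Z where
  toFun0 := ![α, β]
  toFunP := q
  continuous_toFunP := hq
  s_map x := hs x
  t_map x := ht x
  comp_map x y h := absurd (show (1 : Fin 2) = 0 from h) (by decide)

namespace SCofibrantStructure

variable {X : Flow} (sX : SCofibrantStructure X)

theorem cell_bdry (n : ℕ) (i : sX.cells n) (x : diskBoundary n) :
    (sX.cellMap n i).toFunP (diskBoundaryInclusion n x) =
      (sX.ι n).toFunP ((sX.attachMap n i).toFunP x) :=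
  FlowHom.congrP (sX.attach_comm n i) x

theorem cell_state (n : ℕ) (i : sX.cells n) (a : Fin 2) :
    (sX.cellMap n i).toFun0 a = (sX.ι n).toFun0 ((sX.attachMap n i).toFun0 a) :=
  FlowHom.congr0 (sX.attach_comm n i) a

theorem s_cell (n : ℕ) (i : sX.cells n) (x : closedDisk n) :
    (sX.sk (n+1)).s ((sX.cellMap n i).toFunP x) =
      (sX.ι n).toFun0 ((sX.attachMap n i).toFun0 (0 : Fin 2)) := by
  rw [← cell_state]; exact (sX.cellMap n i).s_map x

theorem t_cell (n : ℕ) (i : sX.cells n) (x : closedDisk n) :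
    (sX.sk (n+1)).t ((sX.cellMap n i).toFunP x) =
      (sX.ι n).toFun0 ((sX.attachMap n i).toFun0 (1 : Fin 2)) := by
  rw [← cell_state]; exact (sX.cellMap n i).t_map x

/-- Pushout extension in a convenient form. -/
theorem pushout_extend (n : ℕ) (Z : Flow) (g : FlowHom (sX.sk n) Z)
    (q : sX.cells n → closedDisk n → Z.Path) (hq : ∀ i, Continuous (q i))
    (hb : ∀ i x, q i (diskBoundaryInclusion n x) = g.toFunP ((sX.attachMap n i).toFunP x))
    (hs : ∀ i x, Z.s (q i x) = g.toFun0 ((sX.attachMap n i).toFun0 (0 : Fin 2)))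
    (ht : ∀ i x, Z.t (q i x) = g.toFun0 ((sX.attachMap n i).toFun0 (1 : Fin 2))) :
    ∃ h : FlowHom (sX.sk (n+1)) Z, h.comp (sX.ι n) = g ∧
      ∀ i x, h.toFunP ((sX.cellMap n i).toFunP x) = q i x := by
  obtain ⟨h, ⟨h1, h2⟩, -⟩ := sX.attach_isPushout n Z g
    (fun i => globHom _ _ (q i) (hq i) (hs i) (ht i)) (by
      intro i
      refine FlowHom.ext ?_ (funext fun x => hb i x)
      funext a
      change Fin 2 at a
      fin_cases a <;> rfl)
  exact ⟨h, h1, fun i x => FlowHom.congrP (h2 i) x⟩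

/-- Uniqueness part of the pushout property. -/
theorem pushout_unique (n : ℕ) (Z : Flow) (h h' : FlowHom (sX.sk (n+1)) Z)
    (h1 : h.comp (sX.ι n) = h'.comp (sX.ι n))
    (h2 : ∀ i, h.comp (sX.cellMap n i) = h'.comp (sX.cellMap n i)) : h = h' := by
  refine (sX.attach_isPushout n Z (h'.comp (sX.ι n)) (fun i => h'.comp (sX.cellMap n i)) ?_).unique
    ⟨h1, h2⟩ ⟨rfl, fun _ => rfl⟩
  intro i
  rw [FlowHom.comp_assoc, FlowHom.comp_assoc, sX.attach_comm]

theorem colim_unique (Z : Flow) (h h' : FlowHom X Z)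
    (H : ∀ n, h.comp (sX.incl n) = h'.comp (sX.incl n)) : h = h' := by
  refine (sX.isColimit Z (fun n => h'.comp (sX.incl n)) ?_).unique H (fun _ => rfl)
  intro n
  rw [FlowHom.comp_assoc, sX.incl_comm]

/-- Every path of `sk (n+1)` is a composite of paths of `sk n` and of cells. -/
theorem sk_induction (n : ℕ) (S : Set (sX.sk (n+1)).Path)
    (hS : ∀ x ∈ S, ∀ y ∈ S, ∀ h : (sX.sk (n+1)).t x = (sX.sk (n+1)).s y,
      (sX.sk (n+1)).comp x y h ∈ S)
    (h1 : ∀ x, (sX.ι n).toFunP x ∈ S)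
    (h2 : ∀ i x, (sX.cellMap n i).toFunP x ∈ S) : ∀ x, x ∈ S := by
  obtain ⟨h, ⟨e1, e2⟩, -⟩ := sX.attach_isPushout n (subFlow _ S hS)
    (subFlowLift S hS (sX.ι n) h1) (fun i => subFlowLift S hS (sX.cellMap n i) (h2 i)) (by
      intro i
      refine FlowHom.ext ?_ (funext fun x => Subtype.ext (sX.cell_bdry n i x))
      exact funext fun a => FlowHom.congr0 (sX.attach_comm n i) a)
  have : (subFlowIncl _ S hS).comp h = FlowHom.id _ := by
    apply sX.pushout_unique
    · rw [FlowHom.comp_assoc, e1]; rfl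
    · intro i
      rw [FlowHom.comp_assoc, e2]; rfl
  intro x
  have h2 : (subFlowIncl _ S hS).toFunP (h.toFunP x) ∈ S :=
    Subtype.property (p := (· ∈ S)) (h.toFunP x)
  have e : (subFlowIncl _ S hS).toFunP (h.toFunP x) = x := FlowHom.congrP this x
  rwa [e] at h2

/-- A set of paths closed under composition which contains all skeleta is everything. -/
theorem colim_induction (S : Set X.Path)
    (hS : ∀ x ∈ S, ∀ y ∈ S, ∀ h : X.t x = X.s y, X.comp x y h ∈ S)
    (h1 : ∀ n x, (sX.incl n).toFunP x ∈ S) : ∀ x, x ∈ S := by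
  obtain ⟨h, e1, -⟩ := sX.isColimit (subFlow _ S hS)
    (fun n => subFlowLift S hS (sX.incl n) (h1 n)) (by
      intro n
      refine FlowHom.ext ?_ (funext fun x => Subtype.ext (FlowHom.congrP (sX.incl_comm n) x))
      exact funext fun a => FlowHom.congr0 (sX.incl_comm n) a)
  have : (subFlowIncl _ S hS).comp h = FlowHom.id _ := by
    apply sX.colim_unique
    intro i
    rw [FlowHom.comp_assoc, e1]; rfl
  intro x
  have h2 : (subFlowIncl _ S hS).toFunP (h.toFunP x) ∈ S :=
    Subtype.property (p := (· ∈ S)) (h.toFunP x)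
  have e : (subFlowIncl _ S hS).toFunP (h.toFunP x) = x := FlowHom.congrP this x
  rwa [e] at h2

/-- The iterated inclusion of skeleta. -/
def up {n k : ℕ} (h : n ≤ k) : FlowHom (sX.sk n) (sX.sk k) :=
  Nat.leRec (motive := fun k _ => FlowHom (sX.sk n) (sX.sk k)) (FlowHom.id _)
    (fun k _ e => (sX.ι k).comp e) h

theorem up_self (n : ℕ) : sX.up (le_refl n) = FlowHom.id _ := by
  simp [up]

theorem up_succ {n k : ℕ} (h : n ≤ k) (h' : n ≤ k + 1) :
    sX.up h' = (sX.ι k).comp (sX.up h) := by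
  simp only [up]; rw [Nat.leRec_succ _ _ h]

theorem up_ι {n k : ℕ} (h : n + 1 ≤ k) (h' : n ≤ k) :
    (sX.up h).comp (sX.ι n) = sX.up h' := by
  induction k, h using Nat.le_induction with
  | base => rw [up_self, sX.up_succ (le_refl n), up_self]; rfl
  | succ k hk ih =>
    rw [sX.up_succ hk, sX.up_succ (Nat.le_of_succ_le hk), FlowHom.comp_assoc, ih]

theorem incl_up {n k : ℕ} (h : n ≤ k) : (sX.incl k).comp (sX.up h) = sX.incl n := by
  induction k, h using Nat.le_induction with
  | base => rw [up_self]; rfl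
  | succ k hk ih => rw [sX.up_succ hk, ← FlowHom.comp_assoc, sX.incl_comm, ih]

/-- Building morphisms out of an S-cofibrant flow, skeleton by skeleton. -/
theorem extend_from (N : ℕ) (Z : Flow) (Pred : ∀ n, FlowHom (sX.sk n) Z → Prop)
    (d : FlowHom (sX.sk N) Z) (hd : Pred N d)
    (step : ∀ n, N ≤ n → ∀ e, Pred n e → ∃ e', FlowHom.comp e' (sX.ι n) = e ∧ Pred (n+1) e') :
    ∃ h : FlowHom X Z, h.comp (sX.incl N) = d ∧ ∀ n, N ≤ n → Pred n (h.comp (sX.incl n)) := by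
  classical
  choose st st1 st2 using step
  let e : ∀ j : ℕ, {e : FlowHom (sX.sk (N+j)) Z // Pred (N+j) e} := fun j =>
    Nat.rec (motive := fun j => {e : FlowHom (sX.sk (N+j)) Z // Pred (N+j) e})
      ⟨d, hd⟩ (fun j p => ⟨st (N+j) (Nat.le_add_right _ _) p.1 p.2, st2 _ _ _ _⟩) j
  have e0 : (e 0).1 = d := rfl
  have es : ∀ j, (e (j+1)).1.comp (sX.ι (N+j)) = (e j).1 := fun j => st1 _ _ _ _
  have eup : ∀ j j' (h : j ≤ j'), (e j').1.comp (sX.up (Nat.add_le_add_left h N)) = (e j).1 := by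
    intro j j' h
    induction j', h using Nat.le_induction with
    | base => rw [up_self]; rfl
    | succ k hk ih =>
      rw [sX.up_succ (Nat.add_le_add_left hk N), ← FlowHom.comp_assoc, es, ih]
  obtain ⟨h, hh, -⟩ := sX.isColimit Z (fun n => (e n).1.comp (sX.up (Nat.le_add_left n N))) (by
    intro n
    rw [FlowHom.comp_assoc, sX.up_ι _ (by omega), sX.up_succ (Nat.le_add_left n N),
      ← FlowHom.comp_assoc, es])
  have key : ∀ j, h.comp (sX.incl (N+j)) = (e j).1 := by
    intro j
    rw [hh (N+j)]
    exact eup j (N+j) (by omega)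
  refine ⟨h, key 0, fun n hn => ?_⟩
  obtain ⟨j, rfl⟩ := Nat.exists_eq_add_of_le hn
  rw [key]; exact (e j).2

end SCofibrantStructure

/-! ### States -/

/-- The flow with state set `A` and exactly one path between any two states. -/
def chaotic (A : Type) : Flow :=
  letI : TopologicalSpace (A × A) := ⊥
  haveI : DiscreteTopology (A × A) := ⟨rfl⟩
  { State := A
    Path := A × A
    s := Prod.fst
    t := Prod.snd
    isOpen_preimage_s := fun _ => isOpen_discrete _
    isOpen_preimage_t := fun _ => isOpen_discrete _
    comp := fun x y _ => (x.1, y.2)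
    continuous_comp := by
      haveI : DiscreteTopology ((A × A) × (A × A)) := inferInstance
      exact continuous_of_discreteTopology
    s_comp := fun _ _ _ => rfl
    t_comp := fun _ _ _ => rfl
    comp_assoc := fun _ _ _ _ _ _ _ => rfl }

/-- Morphisms to a chaotic flow are maps on states. -/
def chaoticHom {X : Flow} {A : Type} (f : X.State → A) : FlowHom X (chaotic A) where
  toFun0 := f
  toFunP x := (f (X.s x), f (X.t x))
  continuous_toFunP := by
    letI : TopologicalSpace (A × A) := ⊥
    haveI : DiscreteTopology (A × A) := ⟨rfl⟩
    have h : Continuous (fun x : X.Path => (X.s x, X.t x)) := X.continuous_s.prodMk X.continuous_t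
    exact (continuous_of_discreteTopology
      (f := fun p : X.State × X.State => ((f p.1, f p.2) : A × A))).comp h
  s_map _ := rfl
  t_map _ := rfl
  comp_map x y h h' := by
    change (f _, f _) = (f _, f _)
    rw [X.s_comp, X.t_comp]

theorem chaotic_ext {X : Flow} {A : Type} {f g : FlowHom X (chaotic A)}
    (h : f.toFun0 = g.toFun0) : f = g := by
  refine FlowHom.ext h (funext fun x => Prod.ext ?_ ?_)
  · exact (f.s_map x).trans ((congrFun h _).trans (g.s_map x).symm)
  · exact (f.t_map x).trans ((congrFun h _).trans (g.t_map x).symm)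

namespace SCofibrantStructure

variable {X : Flow} (sX : SCofibrantStructure X)

theorem incl_state_injective (n : ℕ) : Function.Injective (sX.incl n).toFun0 := by
  obtain ⟨h, h1, -⟩ := sX.extend_from n (chaotic (sX.sk n).State) (fun _ _ => True)
    (chaoticHom _root_.id) trivial (by
      intro k _ e _
      obtain ⟨e', ⟨he, -⟩, -⟩ := sX.attach_isPushout k _ e
        (fun i => chaoticHom (fun a => e.toFun0 ((sX.attachMap k i).toFun0 a)))
        (fun i => chaotic_ext rfl)
      exact ⟨e', he, trivial⟩)
  intro a b hab
  have ha := FlowHom.congr0 h1 a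
  have hb := FlowHom.congr0 h1 b
  change h.toFun0 ((sX.incl n).toFun0 a) = a at ha
  change h.toFun0 ((sX.incl n).toFun0 b) = b at hb
  rw [← ha, ← hb, hab]

theorem ι_state_surjective (n : ℕ) : Function.Surjective (sX.ι n).toFun0 := by
  have : (chaoticHom (fun _ => True) : FlowHom (sX.sk (n+1)) (chaotic Prop)) =
      chaoticHom (fun a => ∃ b, (sX.ι n).toFun0 b = a) := by
    apply sX.pushout_unique
    · refine chaotic_ext (funext fun a => ?_)
      exact (eq_true ⟨a, rfl⟩).symm
    · intro i
      refine chaotic_ext (funext fun a => ?_)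
      exact (eq_true ⟨_, (sX.cell_state n i a).symm⟩).symm
  intro a
  exact (of_eq_true (FlowHom.congr0 this a).symm)

theorem incl_state_surjective (n : ℕ) : Function.Surjective (sX.incl n).toFun0 := by
  have key : ∀ k (a : (sX.sk k).State), ∃ b, (sX.incl n).toFun0 b = (sX.incl k).toFun0 a := by
    have h0 : ∀ k (a : (sX.sk k).State), ∃ b : (sX.sk 0).State,
        (sX.incl 0).toFun0 b = (sX.incl k).toFun0 a := by
      intro k
      induction k with
      | zero => exact fun a => ⟨a, rfl⟩
      | succ k ih =>
        intro a
        obtain ⟨b, rfl⟩ := sX.ι_state_surjective k a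
        obtain ⟨c, hc⟩ := ih b
        exact ⟨c, hc.trans (FlowHom.congr0 (sX.incl_comm k) b).symm⟩
    intro k a
    obtain ⟨b, hb⟩ := h0 k a
    exact ⟨(sX.up (Nat.zero_le n)).toFun0 b,
      (FlowHom.congr0 (sX.incl_up (Nat.zero_le n)) b).trans hb⟩
  have : (chaoticHom (fun _ => True) : FlowHom X (chaotic Prop)) =
      chaoticHom (fun a => ∃ b, (sX.incl n).toFun0 b = a) := by
    apply sX.colim_unique
    intro k
    refine chaotic_ext (funext fun a => ?_)
    exact (eq_true (key k a)).symm
  intro a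
  exact (of_eq_true (FlowHom.congr0 this a).symm)

/-- The paths coming from the `n`-th skeleton. -/
def R (n : ℕ) : Set X.Path := Set.range (sX.incl n).toFunP

theorem R_mono {n k : ℕ} (h : n ≤ k) : sX.R n ⊆ sX.R k := by
  rintro _ ⟨x, rfl⟩
  exact ⟨(sX.up h).toFunP x, FlowHom.congrP (sX.incl_up h) x⟩

theorem R_comp (n : ℕ) : ∀ x ∈ sX.R n, ∀ y ∈ sX.R n, ∀ h : X.t x = X.s y,
    X.comp x y h ∈ sX.R n := by
  rintro _ ⟨x, rfl⟩ _ ⟨y, rfl⟩ h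
  have hxy : (sX.sk n).t x = (sX.sk n).s y := by
    apply sX.incl_state_injective n
    rw [← (sX.incl n).t_map, ← (sX.incl n).s_map, h]
  exact ⟨(sX.sk n).comp x y hxy, (sX.incl n).comp_map x y hxy h⟩

theorem incl_ι (n : ℕ) (x : (sX.sk n).Path) :
    (sX.incl (n+1)).toFunP ((sX.ι n).toFunP x) = (sX.incl n).toFunP x :=
  FlowHom.congrP (sX.incl_comm n) x

theorem incl_cell_bdry (n : ℕ) (i : sX.cells n) (x : closedDisk n) (hx : ‖(x : EuclideanSpace ℝ (Fin n))‖ = 1) :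
    (sX.incl (n+1)).toFunP ((sX.cellMap n i).toFunP x) ∈ sX.R n := by
  have := sX.cell_bdry n i ⟨x.1, by simpa using hx⟩
  have e : diskBoundaryInclusion n ⟨x.1, by simpa using hx⟩ = x := rfl
  rw [e] at this
  rw [this, sX.incl_ι]
  exact ⟨_, rfl⟩

end SCofibrantStructure


/-! ### Path-object flows -/

/-- The flow whose paths are the `K`-parametrized families of paths of `Z` with constant
source and target. -/
def PF (Z : Flow) (K : Type) [TopologicalSpace K] [LocallyCompactSpace K] : Flow where
  State := Z.State
  Path := {p : Z.State × Z.State × C(K, Z.Path) //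
    ∀ k, Z.s (p.2.2 k) = p.1 ∧ Z.t (p.2.2 k) = p.2.1}
  s p := p.1.1
  t p := p.1.2.1
  isOpen_preimage_s a := (isOpen_discrete {a}).preimage (by fun_prop)
  isOpen_preimage_t a := (isOpen_discrete {a}).preimage (by fun_prop)
  comp p q h := ⟨(p.1.1, q.1.2.1,
      ⟨fun k => Z.comp (p.1.2.2 k) (q.1.2.2 k) (((p.2 k).2.trans h).trans (q.2 k).1.symm),
        Z.continuous_comp.comp (f := fun k : K =>
          (⟨(p.1.2.2 k, q.1.2.2 k), ((p.2 k).2.trans h).trans (q.2 k).1.symm⟩ :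
            {p : Z.Path × Z.Path // Z.t p.1 = Z.s p.2})) (by fun_prop)⟩),
    fun k => ⟨(Z.s_comp _ _ _).trans (p.2 k).1, (Z.t_comp _ _ _).trans (q.2 k).2⟩⟩
  continuous_comp := by
    refine Continuous.subtype_mk ?_ _
    refine Continuous.prodMk (by fun_prop) (Continuous.prodMk (by fun_prop) ?_)
    refine ContinuousMap.continuous_of_continuous_uncurry _ ?_
    refine Z.continuous_comp.comp (f := fun x :
      {p : {p : Z.State × Z.State × C(K, Z.Path) //
        ∀ k, Z.s (p.2.2 k) = p.1 ∧ Z.t (p.2.2 k) = p.2.1} ×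
        {p : Z.State × Z.State × C(K, Z.Path) //
        ∀ k, Z.s (p.2.2 k) = p.1 ∧ Z.t (p.2.2 k) = p.2.1} // p.1.1.2.1 = p.2.1.1} × K =>
      (⟨(x.1.1.1.1.2.2 x.2, x.1.1.2.1.2.2 x.2),
        ((x.1.1.1.2 x.2).2.trans x.1.2).trans (x.1.1.2.2 x.2).1.symm⟩ :
            {p : Z.Path × Z.Path // Z.t p.1 = Z.s p.2})) ?_
    refine Continuous.subtype_mk ?_ _
    fun_prop
  s_comp _ _ _ := rfl
  t_comp _ _ _ := rfl
  comp_assoc x y z hxy hyz h1 h2 := by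
    apply Subtype.ext
    refine Prod.ext rfl (Prod.ext rfl (ContinuousMap.ext fun k => ?_))
    exact Z.comp_assoc _ _ _ _ _ _ _

namespace PF

variable {Z : Flow} {K : Type} [TopologicalSpace K] [LocallyCompactSpace K]

/-- Evaluation at a parameter. -/
def ev (k : K) : FlowHom (PF Z K) Z where
  toFun0 := _root_.id
  toFunP p := (p.1.2.2 : C(K, Z.Path)) k
  continuous_toFunP := by
    have : Continuous (fun p : {p : Z.State × Z.State × C(K, Z.Path) //
      ∀ k, Z.s (p.2.2 k) = p.1 ∧ Z.t (p.2.2 k) = p.2.1} => p.1.2.2 k) := by fun_prop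
    exact this
  s_map p := (p.2 k).1
  t_map p := (p.2 k).2
  comp_map _ _ _ _ := rfl

@[simp] theorem ev_state (k : K) (a : Z.State) : (ev (Z := Z) k).toFun0 a = a := rfl

theorem continuous_ev :
    Continuous (fun p : (PF Z K).Path × K => (ev (Z := Z) p.2).toFunP p.1) := by
  have : Continuous (fun p : {p : Z.State × Z.State × C(K, Z.Path) //
      ∀ k, Z.s (p.2.2 k) = p.1 ∧ Z.t (p.2.2 k) = p.2.1} × K => p.1.1.2.2 p.2) := by fun_prop
  exact this

/-- Building paths of `PF Z K`. -/
def mk (a b : Z.State) (f : K → Z.Path) (hf : Continuous f) (hs : ∀ k, Z.s (f k) = a)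
    (ht : ∀ k, Z.t (f k) = b) : (PF Z K).Path :=
  ⟨(a, b, ⟨f, hf⟩), fun k => ⟨hs k, ht k⟩⟩

@[simp] theorem ev_mk (a b : Z.State) (f : K → Z.Path) (hf hs ht) (k : K) :
    (ev (Z := Z) k).toFunP (mk a b f hf hs ht) = f k := rfl

@[simp] theorem s_mk (a b : Z.State) (f : K → Z.Path) (hf hs ht) :
    (PF Z K).s (mk a b f hf hs ht) = a := rfl

@[simp] theorem t_mk (a b : Z.State) (f : K → Z.Path) (hf hs ht) :
    (PF Z K).t (mk a b f hf hs ht) = b := rfl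

theorem continuous_mk {A : Type} [TopologicalSpace A] (a b : Z.State) (f : A → K → Z.Path)
    (hf : Continuous (fun p : A × K => f p.1 p.2)) (hs : ∀ x k, Z.s (f x k) = a)
    (ht : ∀ x k, Z.t (f x k) = b) :
    Continuous (fun x => mk a b (f x) (hf.comp (Continuous.prodMk_right x)) (hs x) (ht x)) := by
  refine Continuous.subtype_mk ?_ _
  refine Continuous.prodMk continuous_const (Continuous.prodMk continuous_const ?_)
  exact ContinuousMap.continuous_of_continuous_uncurry _ hf

theorem ext {p q : (PF Z K).Path} (hs : (PF Z K).s p = (PF Z K).s q)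
    (ht : (PF Z K).t p = (PF Z K).t q)
    (h : ∀ k, (ev (Z := Z) k).toFunP p = (ev (Z := Z) k).toFunP q) : p = q :=
  Subtype.ext (Prod.ext hs (Prod.ext ht (ContinuousMap.ext h)))

/-- The constant families. -/
def const (Z : Flow) (K : Type) [TopologicalSpace K] [LocallyCompactSpace K] :
    FlowHom Z (PF Z K) where
  toFun0 := _root_.id
  toFunP x := mk (Z.s x) (Z.t x) (fun _ => x) continuous_const (fun _ => rfl) (fun _ => rfl)
  continuous_toFunP := by
    refine Continuous.subtype_mk ?_ _
    refine Continuous.prodMk Z.continuous_s (Continuous.prodMk Z.continuous_t ?_)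
    exact ContinuousMap.continuous_of_continuous_uncurry _ continuous_fst
  s_map _ := rfl
  t_map _ := rfl
  comp_map x y h h' := by
    refine ext ?_ ?_ (fun k => rfl)
    · exact Z.s_comp _ _ _
    · exact Z.t_comp _ _ _

@[simp] theorem ev_const (k : K) (x : Z.Path) :
    (ev (Z := Z) k).toFunP ((const Z K).toFunP x) = x := rfl

end PF



/-! ### Disks and the homotopy extension property -/

/-- Euclidean space. -/
abbrev EE (n : ℕ) : Type := EuclideanSpace ℝ (Fin n)

/-- Radial clamping onto the closed unit disk. -/
noncomputable def clampFun (n : ℕ) (x : EE n) : EE n := (max 1 ‖x‖)⁻¹ • x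

theorem norm_clampFun (n : ℕ) (x : EE n) : ‖clampFun n x‖ = min 1 ‖x‖ := by
  have h : (0 : ℝ) < max 1 ‖x‖ := lt_of_lt_of_le one_pos (le_max_left _ _)
  rw [clampFun, norm_smul, norm_inv, Real.norm_of_nonneg h.le]
  rcases le_total 1 ‖x‖ with h1 | h1
  · rw [max_eq_right h1, min_eq_left h1, inv_mul_cancel₀ (by linarith)]
  · rw [max_eq_left h1, min_eq_right h1]; simp

theorem continuous_clampFun (n : ℕ) : Continuous (clampFun n) := by
  unfold clampFun
  refine Continuous.smul (Continuous.inv₀ (continuous_const.max continuous_norm) fun x => ?_) continuous_id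
  exact (lt_of_lt_of_le one_pos (le_max_left _ _)).ne'

noncomputable def clampD (n : ℕ) (x : EE n) : closedDisk n :=
  ⟨clampFun n x, by simp [norm_clampFun]⟩

theorem norm_clampD (n : ℕ) (x : EE n) : ‖(clampD n x : EE n)‖ = min 1 ‖x‖ := norm_clampFun n x

theorem continuous_clampD (n : ℕ) : Continuous (clampD n) :=
  (continuous_clampFun n).subtype_mk _

theorem clampD_coe (n : ℕ) (x : closedDisk n) : clampD n (x : EE n) = x := by
  apply Subtype.ext
  have : ‖(x : EE n)‖ ≤ 1 := mem_closedBall_zero_iff.1 x.2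
  simp [clampD, clampFun, max_eq_left this]

theorem disk_norm_le {n : ℕ} (x : closedDisk n) : ‖(x : EE n)‖ ≤ 1 := mem_closedBall_zero_iff.1 x.2

/-- A boundary point. -/
def toBdry {n : ℕ} (x : closedDisk n) (h : ‖(x : EE n)‖ = 1) : diskBoundary n :=
  ⟨x.1, by simpa using h⟩

theorem bdry_toBdry {n : ℕ} (x : closedDisk n) (h : ‖(x : EE n)‖ = 1) :
    diskBoundaryInclusion n (toBdry x h) = x := rfl

theorem norm_bdry {n : ℕ} (x : diskBoundary n) : ‖(diskBoundaryInclusion n x : EE n)‖ = 1 := by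
  exact mem_sphere_zero_iff_norm.1 x.2

theorem toBdry_bdry {n : ℕ} (x : diskBoundary n) (h) : toBdry (diskBoundaryInclusion n x) h = x := rfl

/-- Collared homotopy extension for the pair (disk, sphere). -/
theorem hep {P : Type} [TopologicalSpace P] (n : ℕ) (c : closedDisk n → P) (hc : Continuous c)
    (b : diskBoundary n → unitInterval → P)
    (hb : Continuous (fun p : diskBoundary n × unitInterval => b p.1 p.2))
    (hbc : ∀ x, b x 0 = c (diskBoundaryInclusion n x)) :
    ∃ F : closedDisk n → unitInterval → P,
      Continuous (fun p : closedDisk n × unitInterval => F p.1 p.2) ∧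
      (∀ x, F x 0 = c x) ∧ (∀ x u, F (diskBoundaryInclusion n x) u = b x u) ∧
      (∀ x : closedDisk n, 3/4 ≤ ‖(x : EE n)‖ → ∃ x', F x 1 = b x' 1) ∧
      (∀ x u, (∃ x', F x u = c x') ∨ (∃ x' u', F x u = b x' u')) := by
  classical
  let w : closedDisk n × unitInterval → closedDisk n := fun p =>
    clampD n ((1 + (p.2 : ℝ)) • (p.1 : EE n))
  let s : closedDisk n × unitInterval → ℝ := fun p => (1 + (p.2 : ℝ)) * ‖(p.1 : EE n)‖
  let τ : closedDisk n × unitInterval → unitInterval := fun p =>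
    Set.projIcc 0 1 zero_le_one (min (p.2 : ℝ) (2 * (s p - 1)))
  have hw : Continuous w := (continuous_clampD n).comp (by fun_prop)
  have hs : Continuous s := by fun_prop
  have hτ : Continuous τ := continuous_projIcc.comp (by fun_prop)
  have hsn : ∀ p : closedDisk n × unitInterval, ‖(1 + (p.2 : ℝ)) • (p.1 : EE n)‖ = s p := by
    intro p
    rw [norm_smul, Real.norm_of_nonneg (by have := p.2.2.1; linarith)]
  have hw1 : ∀ p, 1 ≤ s p → ‖(w p : EE n)‖ = 1 := by
    intro p hp
    rw [norm_clampD, hsn, min_eq_left hp]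
  let G : closedDisk n × unitInterval → P := fun p =>
    if h : ‖(w p : EE n)‖ = 1 then b (toBdry (w p) h) (τ p) else c (w p)
  have hG : ∀ p (h : 1 ≤ s p), G p = b (toBdry (w p) (hw1 p h)) (τ p) := fun p h => dif_pos (hw1 p h)
  let F : closedDisk n × unitInterval → P := fun p => if s p ≤ 1 then c (w p) else G p
  have F1 : ∀ p, s p ≤ 1 → F p = c (w p) := fun p h => if_pos h
  have hτ0 : ∀ p, s p = 1 → τ p = 0 := by
    intro p hp
    have : min (p.2 : ℝ) (2 * (s p - 1)) = 0 := by
      rw [hp]; have := p.2.2.1; simpa using this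
    exact Set.projIcc_of_le_left _ (le_of_eq this)
  have hglue : ∀ p, s p = 1 → c (w p) = G p := by
    intro p hp
    rw [hG p hp.ge, hτ0 p hp, hbc, bdry_toBdry]
  have F2 : ∀ p (h : 1 ≤ s p), F p = b (toBdry (w p) (hw1 p h)) (τ p) := by
    intro p h
    rcases h.eq_or_lt with h1 | h1
    · rw [F1 p h1.ge, hglue p h1.symm, hG p h]
    · exact (if_neg (not_le.2 h1)).trans (hG p h)
  refine ⟨fun x u => F (x, u), ?_, ?_, ?_, ?_, ?_⟩
  · refine continuous_if_le hs continuous_const (hc.comp hw).continuousOn ?_ hglue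
    rw [continuousOn_iff_continuous_domRestrict]
    change Continuous (Set.domRestrict {p | 1 ≤ s p} G)
    have : Set.domRestrict {p | 1 ≤ s p} G = fun p : {p | 1 ≤ s p} =>
        b (toBdry (w p.1) (hw1 p.1 p.2)) (τ p.1) := funext fun p => hG p.1 p.2
    rw [this]
    refine hb.comp (f := fun p : {p | 1 ≤ s p} => (toBdry (w p.1) (hw1 p.1 p.2), τ p.1)) ?_
    refine Continuous.prodMk (Continuous.subtype_mk ?_ _) (hτ.comp continuous_subtype_val)
    exact continuous_subtype_val.comp (hw.comp continuous_subtype_val)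
  · intro x
    have h : s (x, 0) ≤ 1 := by simpa [s] using disk_norm_le x
    change F (x, 0) = c x
    rw [F1 _ h]
    have : w (x, 0) = x := by
      have := clampD_coe n x
      simpa [w] using this
    rw [this]
  · intro x u
    have hx : ‖(diskBoundaryInclusion n x : EE n)‖ = 1 := norm_bdry x
    have hs1 : s (diskBoundaryInclusion n x, u) = 1 + u := by simp [s, hx]
    have h : 1 ≤ s (diskBoundaryInclusion n x, u) := by rw [hs1]; have := u.2.1; linarith
    change F (diskBoundaryInclusion n x, u) = b x u
    rw [F2 _ h]
    congr 1
    · apply Subtype.ext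
      change clampFun n ((1 + (u : ℝ)) • (x : EE n)) = x
      have hx' : ‖(x : EE n)‖ = 1 := hx
      have hu := u.2.1
      rw [clampFun, norm_smul, hx', Real.norm_of_nonneg (by linarith), mul_one,
        max_eq_right (by linarith), inv_smul_smul₀ (by linarith)]
    · have : min (u : ℝ) (2 * (s (diskBoundaryInclusion n x, u) - 1)) = u := by
        rw [hs1]; apply min_eq_left; have := u.2.1; linarith
      change Set.projIcc 0 1 zero_le_one (min (u : ℝ) (2 * (s (diskBoundaryInclusion n x, u) - 1))) = u
      rw [this]; exact Set.projIcc_val _ u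
  · intro x hx
    have hs1 : s (x, 1) = 2 * ‖(x : EE n)‖ := by simp [s]; norm_num
    have h : 1 ≤ s (x, 1) := by rw [hs1]; linarith
    refine ⟨toBdry (w (x,1)) (hw1 _ h), ?_⟩
    change F (x, 1) = _
    rw [F2 _ h]
    congr 1
    have : (1 : ℝ) ≤ min ((1 : unitInterval) : ℝ) (2 * (s (x, 1) - 1)) := by
      rw [hs1]; apply le_min; · simp
      linarith
    exact Set.projIcc_of_right_le _ this
  · intro x u
    rcases le_total (s (x,u)) 1 with h | h
    · exact Or.inl ⟨_, F1 _ h⟩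
    · exact Or.inr ⟨_, _, F2 _ h⟩


open scoped NNReal

/-! ### Compact families of paths live in a finite skeleton -/

/-- The one-state flow of nonnegative reals with composition `max`. -/
noncomputable def maxFlow : Flow where
  State := Unit
  Path := ℝ≥0
  s _ := ()
  t _ := ()
  isOpen_preimage_s a := isOpen_preimage_const _ a
  isOpen_preimage_t a := isOpen_preimage_const _ a
  comp x y _ := max x y
  continuous_comp := by fun_prop
  s_comp _ _ _ := rfl
  t_comp _ _ _ := rfl
  comp_assoc x y z _ _ _ _ := (max_assoc x y z).symm

/-- The value of a morphism to `maxFlow`. -/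
def mval {X : Flow} (ν : FlowHom X maxFlow) (x : X.Path) : ℝ≥0 := ν.toFunP x

theorem continuous_mval {X : Flow} (ν : FlowHom X maxFlow) : Continuous (mval ν) :=
  ν.continuous_toFunP

theorem mval_comp {X : Flow} (ν : FlowHom X maxFlow) (x y : X.Path) (h) :
    mval ν (X.comp x y h) = max (mval ν x) (mval ν y) :=
  ν.comp_map x y h (ν.composable h)

theorem isClosedEmbedding_bdry (n : ℕ) :
    Topology.IsClosedEmbedding (diskBoundaryInclusion n) := by
  refine (diskBoundaryInclusion n).continuous.isClosedEmbedding ?_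
  intro x y h
  exact Subtype.ext (congrArg (fun z : closedDisk n => (z : EE n)) h)

namespace SCofibrantStructure

variable {Y : Flow} (sY : SCofibrantStructure Y)

theorem path_induction (S : Set Y.Path)
    (hS : ∀ x ∈ S, ∀ y ∈ S, ∀ h : Y.t x = Y.s y, Y.comp x y h ∈ S)
    (hc : ∀ n i (x : closedDisk n), ‖(x : EE n)‖ < 1 →
      (sY.incl (n+1)).toFunP ((sY.cellMap n i).toFunP x) ∈ S) : ∀ y, y ∈ S := by
  apply sY.colim_induction S hS
  intro n
  induction n with
  | zero => intro x; exact (sY.isEmpty_path_sk_zero.false x).elim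
  | succ n ih =>
    refine sY.sk_induction n {x | (sY.incl (n+1)).toFunP x ∈ S} ?_ ?_ ?_
    · intro x hx y hy h
      have h' := (sY.incl (n+1)).composable h
      change (sY.incl (n+1)).toFunP _ ∈ S
      rw [(sY.incl (n+1)).comp_map x y h h']
      exact hS _ hx _ hy _
    · intro x
      change (sY.incl (n+1)).toFunP _ ∈ S
      rw [sY.incl_ι]
      exact ih x
    · intro i x
      rcases (disk_norm_le x).eq_or_lt with h | h
      · obtain ⟨y, hy⟩ := sY.incl_cell_bdry n i x h
        change (sY.incl (n+1)).toFunP _ ∈ S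
        rw [← hy]; exact ih y
      · exact hc n i x h

/-- A path outside the `k`-th skeleton contains a letter of dimension at least `k`. -/
theorem letter (y : Y.Path) : ∀ k, y ∉ sY.R k → ∃ l, k ≤ l ∧ ∃ (i : sY.cells l) (x : closedDisk l),
    ‖(x : EE l)‖ < 1 ∧ ∀ ν : FlowHom Y maxFlow,
      mval ν ((sY.incl (l+1)).toFunP ((sY.cellMap l i).toFunP x)) ≤ mval ν y := by
  refine sY.path_induction {y | ∀ k, y ∉ sY.R k → ∃ l, k ≤ l ∧ ∃ (i : sY.cells l) (x : closedDisk l),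
    ‖(x : EE l)‖ < 1 ∧ ∀ ν : FlowHom Y maxFlow,
      mval ν ((sY.incl (l+1)).toFunP ((sY.cellMap l i).toFunP x)) ≤ mval ν y} ?_ ?_ y
  · intro x hx y hy h k hk
    by_cases hxk : x ∈ sY.R k
    · have hyk : y ∉ sY.R k := fun hyk => hk (sY.R_comp k x hxk y hyk h)
      obtain ⟨l, hl, i, z, hz, H⟩ := hy k hyk
      refine ⟨l, hl, i, z, hz, fun ν => ?_⟩
      rw [mval_comp]
      exact (H ν).trans (le_max_right _ _)
    · obtain ⟨l, hl, i, z, hz, H⟩ := hx k hxk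
      refine ⟨l, hl, i, z, hz, fun ν => ?_⟩
      rw [mval_comp]
      exact (H ν).trans (le_max_left _ _)
  · intro n i x hx k hk
    refine ⟨n, ?_, i, x, hx, fun ν => le_rfl⟩
    by_contra hn
    exact hk (sY.R_mono (by omega : n + 1 ≤ k) ⟨_, rfl⟩)

theorem exists_large (r : ℕ → ℝ≥0) (hr : ∀ k, 0 < r k) (n : ℕ) :
    ∃ C : ℝ≥0, ∀ k ≤ n, (k : ℝ≥0) ≤ C * r k := by
  refine ⟨∑ k ∈ Finset.range (n+1), (k : ℝ≥0) / r k, fun k hk => ?_⟩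
  have h2 := Finset.single_le_sum (f := fun k : ℕ => (k : ℝ≥0) / r k) (fun _ _ => zero_le)
    (Finset.mem_range.2 (Nat.lt_succ_of_le hk))
  calc (k : ℝ≥0) = k / r k * r k := (div_mul_cancel₀ _ (hr k).ne').symm
    _ ≤ _ := by gcongr

/-- Extending a morphism to `maxFlow` over the cells, with large values inside. -/
theorem maxFlow_step (n : ℕ) (e : FlowHom (sY.sk n) maxFlow) (C : ℝ≥0) :
    ∃ h : FlowHom (sY.sk (n+1)) maxFlow, h.comp (sY.ι n) = e ∧
      ∀ i (x : closedDisk n), C * Real.toNNReal (1 - ‖(x : EE n)‖) ≤ mval h ((sY.cellMap n i).toFunP x) := by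
  have : ∀ i : sY.cells n, ∃ g : C(closedDisk n, ℝ≥0),
      g ∘ diskBoundaryInclusion n = fun x => mval e ((sY.attachMap n i).toFunP x) := fun i =>
    ContinuousMap.exists_extension' (isClosedEmbedding_bdry n)
      ⟨fun x => mval e ((sY.attachMap n i).toFunP x),
        (continuous_mval e).comp (sY.attachMap n i).continuous_toFunP⟩
  choose g hg using this
  let q : sY.cells n → closedDisk n → ℝ≥0 := fun i x =>
    g i x + C * Real.toNNReal (1 - ‖(x : EE n)‖)
  have hq : ∀ i, Continuous (q i) := by intro i; fun_prop
  have hb : ∀ i x, q i (diskBoundaryInclusion n x) = mval e ((sY.attachMap n i).toFunP x) := by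
    intro i x
    have h1 := congrFun (hg i) x
    simp only [Function.comp_apply] at h1
    simp only [q]
    rw [h1, norm_bdry]
    simp
  obtain ⟨h, h1, h2⟩ := sY.pushout_extend n maxFlow e q hq hb (fun _ _ => rfl) (fun _ _ => rfl)
  refine ⟨h, h1, fun i x => ?_⟩
  have h3 : mval h ((sY.cellMap n i).toFunP x) = q i x := h2 i x
  rw [h3]
  exact le_add_self

/-- Lower bounds prescribed on finitely many letters in each dimension. -/
def letterPred (L : ℕ → Σ n, sY.cells n × closedDisk n) : ∀ n, FlowHom (sY.sk n) maxFlow → Prop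
  | 0 => fun _ => True
  | n+1 => fun e => ∀ k i x, L k = ⟨n, i, x⟩ →
        (k : ℝ≥0) ≤ mval e ((sY.cellMap n i).toFunP x)

/-- The zero morphism on the empty skeleton. -/
def maxZero : FlowHom (sY.sk 0) maxFlow where
  toFun0 := fun _ => ()
  toFunP := fun _ => (0 : ℝ≥0)
  continuous_toFunP := continuous_const
  s_map := fun _ => rfl
  t_map := fun _ => rfl
  comp_map := fun x => (sY.isEmpty_path_sk_zero.false x).elim

/-- The norm of a letter. -/
noncomputable def letterNorm (p : Σ n, sY.cells n × closedDisk n) : ℝ := ‖(p.2.2 : EE p.1)‖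

theorem exists_skeleton {D : Type} [TopologicalSpace D] [CompactSpace D]
    (φ : D → Y.Path) (hφ : Continuous φ) : ∃ N, ∀ z, φ z ∈ sY.R N := by
  by_contra hcon
  push Not at hcon
  choose z hz using hcon
  have := fun k => sY.letter (φ (z k)) k (hz k)
  choose l hl i x hx H using this
  let L : ℕ → Σ n, sY.cells n × closedDisk n := fun k => ⟨l k, i k, x k⟩
  have hL : ∀ k, sY.letterNorm (L k) < 1 := hx
  have hr : ∀ k, 0 < Real.toNNReal (1 - sY.letterNorm (L k)) := by
    intro k
    have := hL k
    rw [Real.toNNReal_pos]; linarith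
  choose C hC0 using exists_large _ hr
  have hC : ∀ n k (i : sY.cells n) (x : closedDisk n), L k = ⟨n, i, x⟩ →
      (k : ℝ≥0) ≤ C n * Real.toNNReal (1 - ‖(x : EE n)‖) := by
    intro n k i x h
    have h1 : k ≤ n := by
      have h2 : (L k).1 = n := by rw [h]
      have h3 : (L k).1 = l k := rfl
      have := hl k
      omega
    have h3 := hC0 n k h1
    have : sY.letterNorm (L k) = ‖(x : EE n)‖ := by rw [h]; rfl
    rw [this] at h3
    exact h3
  obtain ⟨ν, -, hν⟩ := sY.extend_from 0 maxFlow (sY.letterPred L) sY.maxZero trivial (by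
      intro n _ e _
      obtain ⟨h, h1, h2⟩ := sY.maxFlow_step n e (C n)
      exact ⟨h, h1, fun k i x hk => (hC n k i x hk).trans (h2 i x)⟩)
  have key : ∀ k : ℕ, (k : ℝ≥0) ≤ mval ν (φ (z k)) := by
    intro k
    exact (hν (l k + 1) (Nat.zero_le _) k (i k) (x k) rfl).trans (H k ν)
  obtain ⟨B, hB⟩ := (isCompact_range ((continuous_mval ν).comp hφ)).bddAbove
  obtain ⟨k, hk⟩ := exists_nat_gt B
  exact absurd ((key k).trans (hB ⟨z k, rfl⟩)) (not_le.2 hk)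

end SCofibrantStructure


/-! ### General position -/

theorem exists_avoid {n m : ℕ} (hnm : n < m) (F : List C(closedDisk n, EE m)) :
    ∀ δ : ℝ, 0 < δ → ∃ v : C(closedDisk n, EE m), ∃ ε : ℝ, 0 < ε ∧ (∀ z, ‖v z‖ ≤ δ) ∧
      ∀ c ∈ F, ∀ z, ε ≤ ‖v z - c z‖ := by
  induction F with
  | nil =>
    intro δ hδ
    exact ⟨ContinuousMap.const _ 0, 1, one_pos, fun z => by simpa using hδ.le, by simp⟩
  | cons c F ih =>
    intro δ hδ
    obtain ⟨v, ε, hε, hv, hF⟩ := ih (δ/2) (by linarith)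
    obtain ⟨η, hη, hη1, hη2⟩ : ∃ η : ℝ, 0 < η ∧ η ≤ ε / 4 ∧ η ≤ δ / 4 :=
      ⟨min (ε/4) (δ/4), lt_min (by linarith) (by linarith), min_le_left _ _, min_le_right _ _⟩
    have hw : Continuous (fun x : EE n => v (clampD n x) - c (clampD n x)) :=
      ((v.continuous.comp (continuous_clampD n)).sub (c.continuous.comp (continuous_clampD n)))
    obtain ⟨g, hg, hgw, -⟩ := hw.exists_contDiff_approx 1 (ε := fun _ => η) continuous_const
      (fun _ => hη)
    have hd := hg.dense_compl_range_of_finrank_lt_finrank (by simpa using hnm)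
    obtain ⟨p, hp, hpr⟩ := hd.exists_dist_lt 0 hη
    rw [dist_zero_left] at hpr
    let v' : C(closedDisk n, EE m) := ⟨fun z => c z + (g z - p), by
      have := hg.continuous
      fun_prop⟩
    have hvv : ∀ z, ‖v' z - v z‖ ≤ 2 * η := by
      intro z
      have h1 := hgw z
      rw [clampD_coe, dist_eq_norm] at h1
      have : v' z - v z = (g z - (v z - c z)) - p := by
        change c z + (g z - p) - v z = _
        abel
      rw [this]
      refine (norm_sub_le _ _).trans ?_
      linarith
    obtain ⟨ε', hε', hmin⟩ : ∃ ε' : ℝ, 0 < ε' ∧ ∀ z : closedDisk n, ε' ≤ ‖g z - p‖ := by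
      have hcont : Continuous (fun z : closedDisk n => ‖g z - p‖) := by
        have := hg.continuous
        fun_prop
      have : Nonempty (closedDisk n) := ⟨⟨0, by simp⟩⟩
      obtain ⟨z0, -, hz0⟩ := isCompact_univ.exists_isMinOn Set.univ_nonempty hcont.continuousOn
      refine ⟨‖g z0 - p‖, ?_, fun z => hz0 (Set.mem_univ z)⟩
      rw [norm_pos_iff, sub_ne_zero]
      exact fun h => hp ⟨_, h⟩
    refine ⟨v', min ε' (ε/2), lt_min hε' (by linarith), fun z => ?_, ?_⟩
    · have h1 := norm_le_norm_add_norm_sub' (v' z) (v z)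
      have := hvv z; have := hv z
      linarith
    · intro c' hc' z
      rcases List.mem_cons.1 hc' with rfl | hc'
      · refine (min_le_left _ _).trans ?_
        have : v' z - c' z = g z - p := by
          change c' z + (g z - p) - c' z = _
          abel
        rw [this]; exact hmin z
      · refine (min_le_right _ _).trans ?_
        have h1 := hF c' hc' z
        have h2 := hvv z
        have h3 := norm_sub_le_norm_sub_add_norm_sub (v z) (v' z) (c' z)
        rw [norm_sub_rev (v z) (v' z)] at h3
        linarith

/-- Pushing radially away from a moving centre. -/
noncomputable def push {n m : ℕ} (v : C(closedDisk n, EE m)) (ε : ℝ) (z : closedDisk n)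
    (u : unitInterval) (c : closedDisk m) : closedDisk m :=
  clampD m ((c : EE m) + ((u : ℝ) * (4 + 3 / ε) * (1 - ‖(c : EE m)‖)) • ((c : EE m) - v z))

theorem continuous_push {n m : ℕ} (v : C(closedDisk n, EE m)) (ε : ℝ) :
    Continuous (fun p : closedDisk n × unitInterval × closedDisk m => push v ε p.1 p.2.1 p.2.2) :=
  (continuous_clampD m).comp (by fun_prop)

theorem push_zero {n m : ℕ} (v : C(closedDisk n, EE m)) (ε : ℝ) (z : closedDisk n)
    (c : closedDisk m) : push v ε z 0 c = c := by
  simp [push, clampD_coe]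

theorem push_bdry {n m : ℕ} (v : C(closedDisk n, EE m)) (ε : ℝ) (z : closedDisk n)
    (u : unitInterval) (c : closedDisk m) (hc : ‖(c : EE m)‖ = 1) : push v ε z u c = c := by
  simp [push, clampD_coe, hc]

theorem push_one {n m : ℕ} (v : C(closedDisk n, EE m)) (ε : ℝ) (hε : 0 < ε)
    (hv : ∀ z, ‖v z‖ ≤ 1/4) (z : closedDisk n)
    (c : closedDisk m) (hc : 1/2 ≤ ‖(c : EE m)‖ ∨ ε ≤ ‖v z - c‖) :
    ‖(push v ε z 1 c : EE m)‖ = 1 := by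
  rw [push, norm_clampD, min_eq_left_iff]
  simp only [Set.Icc.coe_one, one_mul]
  have hv := hv z
  have hc1 := disk_norm_le c
  have hK : 0 < 3 / ε := by positivity
  set K := 3 / ε with hKdef
  have hKε : K * ε = 3 := by rw [hKdef]; field_simp
  set x : EE m := (c : EE m)
  set r := ‖x‖
  have hl : 0 ≤ (4 + K) * (1 - r) := by apply mul_nonneg <;> linarith
  by_cases h : 1/2 ≤ r
  · have e : x + ((4 + K) * (1 - r)) • (x - v z) =
        (1 + (4 + K) * (1 - r)) • x - ((4 + K) * (1 - r)) • v z := by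
      rw [add_smul, one_smul, smul_sub]; abel
    rw [e]
    refine le_trans ?_ (norm_sub_norm_le _ _)
    rw [norm_smul, norm_smul, Real.norm_of_nonneg hl, Real.norm_of_nonneg (by linarith)]
    change 1 ≤ (1 + (4 + K) * (1 - r)) * r - (4 + K) * (1 - r) * ‖v z‖
    nlinarith [mul_nonneg hl (by linarith : 0 ≤ r - ‖v z‖ - 1/4), mul_nonneg hK.le (by linarith : 0 ≤ 1 - r)]
  · have h2 : ε ≤ ‖x - v z‖ := by
      rw [norm_sub_rev]; exact hc.resolve_left h
    push Not at h
    have h3 : ‖((4 + K) * (1 - r)) • (x - v z)‖ - ‖x‖ ≤ ‖x + ((4 + K) * (1 - r)) • (x - v z)‖ := by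
      have := norm_sub_norm_le (((4 + K) * (1 - r)) • (x - v z)) (-x)
      rw [norm_neg, sub_neg_eq_add, add_comm _ x] at this
      exact this
    refine le_trans ?_ h3
    rw [norm_smul, Real.norm_of_nonneg hl]
    change 1 ≤ (4 + K) * (1 - r) * ‖x - v z‖ - r
    have h4 : (4 + K) * (1 - r) * ε ≤ (4 + K) * (1 - r) * ‖x - v z‖ :=
      mul_le_mul_of_nonneg_left h2 hl
    nlinarith [mul_nonneg hε.le (by linarith : 0 ≤ 1 - r)]


open scoped Topology

/-! ### The letter-extraction flow -/

/-- Words in `V` (of length `k`, padded), together with a generic absorbing point. -/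
inductive WordT (V : Type) : Type
  | inf : WordT V
  | word (k : ℕ) (f : ℕ → V) : WordT V

set_option linter.unusedSectionVars false

namespace WordT

variable {V : Type}

instance [TopologicalSpace V] : TopologicalSpace (WordT V) where
  IsOpen U := (inf ∈ U → U = Set.univ) ∧ ∀ k, IsOpen {f : ℕ → V | word k f ∈ U}
  isOpen_univ := ⟨fun _ => rfl, fun k => isOpen_univ⟩
  isOpen_inter U U' h h' := by
    refine ⟨fun hi => ?_, fun k => (h.2 k).inter (h'.2 k)⟩
    rw [h.1 hi.1, h'.1 hi.2, Set.univ_inter]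
  isOpen_sUnion S h := by
    refine ⟨fun hi => ?_, fun k => ?_⟩
    · obtain ⟨U, hU, hi⟩ := hi
      exact Set.eq_univ_of_univ_subset (((h U hU).1 hi) ▸ Set.subset_sUnion_of_mem hU)
    · have : {f : ℕ → V | word k f ∈ ⋃₀ S} = ⋃ U ∈ S, {f | word k f ∈ U} := by
        ext f; simp
      rw [this]
      exact isOpen_biUnion fun U hU => (h U hU).2 k

variable [TopologicalSpace V]

theorem isOpen_iff' (U : Set (WordT V)) :
    IsOpen U ↔ (inf ∈ U → U = Set.univ) ∧ ∀ k, IsOpen {f : ℕ → V | word k f ∈ U} := Iff.rfl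

theorem continuous_word (k : ℕ) : Continuous (word k : (ℕ → V) → WordT V) :=
  ⟨fun U hU => ((isOpen_iff' U).1 hU).2 k⟩

theorem isOpenMap_word (k : ℕ) : IsOpenMap (word k : (ℕ → V) → WordT V) := by
  intro U hU
  rw [isOpen_iff']
  refine ⟨fun ⟨f, _, hf⟩ => (by cases hf), fun l => ?_⟩
  by_cases h : l = k
  · subst h
    convert hU using 1
    ext f
    simp
  · convert isOpen_empty using 1
    ext f
    simp only [Set.mem_ofPred_eq, Set.mem_image, word.injEq, Set.mem_empty_iff_false, iff_false]
    rintro ⟨g, -, hg, -⟩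
    exact h hg.symm

theorem eq_univ_of_inf {U : Set (WordT V)} (hU : IsOpen U) (h : inf ∈ U) : U = Set.univ :=
  ((isOpen_iff' U).1 hU).1 h


/-- Concatenation of padded words. -/
def cat (k : ℕ) (f g : ℕ → V) : ℕ → V := fun j => if j < k then f j else g (j - k)

/-- Composition of words. -/
def mul : WordT V → WordT V → WordT V
  | word k f, word l g => word (k + l) (cat k f g)
  | _, _ => inf

theorem mul_inf (x : WordT V) : mul x inf = inf := by cases x <;> rfl

theorem inf_mul (x : WordT V) : mul inf x = inf := rfl

theorem mul_word (k l : ℕ) (f g : ℕ → V) :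
    mul (word k f) (word l g) = word (k + l) (cat k f g) := rfl

theorem mul_assoc' (x y z : WordT V) : mul x (mul y z) = mul (mul x y) z := by
  cases x with
  | inf => rfl
  | word k f =>
    cases y with
    | inf => rfl
    | word l g =>
      cases z with
      | inf => rfl
      | word r h =>
        simp only [mul_word]
        congr 1
        · omega
        · funext j
          unfold cat
          by_cases h1 : j < k
          · simp [h1, Nat.lt_add_right l h1]
          · by_cases h2 : j - k < l
            · simp [h1, h2, show j < k + l by omega]
            · simp [h1, h2, show ¬ j < k + l by omega, show j - k - l = j - (k + l) by omega]

theorem continuous_cat (k : ℕ) :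
    Continuous (fun p : (ℕ → V) × (ℕ → V) => cat k p.1 p.2) := by
  refine continuous_pi fun j => ?_
  unfold cat
  by_cases h : j < k
  · simp only [h, if_true]; fun_prop
  · simp only [h, if_false]; fun_prop

theorem continuous_mul' : Continuous (fun p : WordT V × WordT V => mul p.1 p.2) := by
  rw [continuous_iff_continuousAt]
  have hinf : ∀ p : WordT V × WordT V, mul p.1 p.2 = inf →
      ContinuousAt (fun p : WordT V × WordT V => mul p.1 p.2) p := by
    intro p hp
    rw [ContinuousAt, hp, tendsto_nhds]
    intro U hU h
    rw [eq_univ_of_inf hU h]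
    simp
  rintro ⟨x, y⟩
  cases x with
  | inf => exact hinf _ rfl
  | word k f =>
    cases y with
    | inf => exact hinf _ rfl
    | word l g =>
      have ho : IsOpenMap (Prod.map (word k) (word l) : (ℕ → V) × (ℕ → V) → _) :=
        (isOpenMap_word k).prodMap (isOpenMap_word l)
      rw [ContinuousAt, tendsto_nhds]
      intro U hU h
      have hV : IsOpen {p : (ℕ → V) × (ℕ → V) | word (k+l) (cat k p.1 p.2) ∈ U} :=
        hU.preimage ((continuous_word (k+l)).comp (continuous_cat k))
      refine Filter.mem_of_superset ((ho _ hV).mem_nhds ⟨(f, g), h, rfl⟩) ?_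
      rintro _ ⟨⟨f', g'⟩, h', rfl⟩
      exact h'

def coords (f0 : ℕ → V) : WordT V → ℕ → V
  | inf => f0
  | word _ f => f

theorem continuousOn_coords (f0 : ℕ → V) (k : ℕ) :
    ContinuousOn (coords f0) (Set.range (word k : (ℕ → V) → WordT V)) := by
  rintro _ ⟨f, rfl⟩
  apply ContinuousAt.continuousWithinAt
  rw [ContinuousAt, tendsto_nhds]
  intro U hU h
  refine Filter.mem_of_superset ((isOpenMap_word k _ hU).mem_nhds ⟨f, h, rfl⟩) ?_
  rintro _ ⟨f', h', rfl⟩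
  exact h'

end WordT

/-- The flow of words. -/
def wordFlow (V : Type) [TopologicalSpace V] : Flow where
  State := Unit
  Path := WordT V
  s _ := ()
  t _ := ()
  isOpen_preimage_s a := isOpen_preimage_const _ a
  isOpen_preimage_t a := isOpen_preimage_const _ a
  comp x y _ := WordT.mul x y
  continuous_comp := WordT.continuous_mul'.comp continuous_subtype_val
  s_comp _ _ _ := rfl
  t_comp _ _ _ := rfl
  comp_assoc x y z _ _ _ _ := WordT.mul_assoc' x y z

def wval {X : Flow} {V : Type} [TopologicalSpace V] (ν : FlowHom X (wordFlow V)) (x : X.Path) :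
    WordT V := ν.toFunP x

theorem continuous_wval {X : Flow} {V : Type} [TopologicalSpace V]
    (ν : FlowHom X (wordFlow V)) : Continuous (wval ν) := ν.continuous_toFunP

theorem wval_comp {X : Flow} {V : Type} [TopologicalSpace V] (ν : FlowHom X (wordFlow V))
    (x y : X.Path) (h) : wval ν (X.comp x y h) = WordT.mul (wval ν x) (wval ν y) :=
  ν.comp_map x y h (ν.composable h)

namespace SCofibrantStructure

variable {Y : Flow} (sY : SCofibrantStructure Y)

/-- Words extend over cells. -/
theorem word_step {V : Type} [TopologicalSpace V] (n : ℕ) (e : FlowHom (sY.sk n) (wordFlow V)) :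
    ∃ h : FlowHom (sY.sk (n+1)) (wordFlow V), h.comp (sY.ι n) = e := by
  classical
  have hn : ∀ x : closedDisk n, 1/2 < ‖(x : EE n)‖ →
      ‖(clampD n ((2:ℝ) • (x : EE n)) : EE n)‖ = 1 := by
    intro x hx
    rw [norm_clampD, norm_smul, min_eq_left]
    rw [Real.norm_of_nonneg (by norm_num)]; linarith
  let q : sY.cells n → closedDisk n → WordT V := fun i x =>
    if h : 1/2 < ‖(x : EE n)‖ then
      wval e ((sY.attachMap n i).toFunP (toBdry (clampD n ((2:ℝ) • (x : EE n))) (hn x h)))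
    else WordT.inf
  have hq : ∀ i, Continuous (q i) := by
    intro i
    refine ⟨fun U hU => ?_⟩
    by_cases hi : WordT.inf ∈ U
    · rw [WordT.eq_univ_of_inf hU hi]; exact isOpen_univ
    · let W : Set (closedDisk n) := {x | 1/2 < ‖(x : EE n)‖}
      have hW : IsOpen W := isOpen_lt continuous_const (by fun_prop)
      let g : W → WordT V := fun x =>
        wval e ((sY.attachMap n i).toFunP (toBdry (clampD n ((2:ℝ) • (x.1 : EE n))) (hn x.1 x.2)))
      have hg : Continuous g := by
        refine (continuous_wval e).comp ((sY.attachMap n i).continuous_toFunP.comp ?_)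
        refine Continuous.subtype_mk ?_ _
        exact continuous_subtype_val.comp ((continuous_clampD n).comp (by fun_prop))
      have : q i ⁻¹' U = Subtype.val '' (g ⁻¹' U) := by
        ext x
        constructor
        · intro hx
          by_cases h : 1/2 < ‖(x : EE n)‖
          · refine ⟨⟨x, h⟩, ?_, rfl⟩
            have : q i x = g ⟨x, h⟩ := dif_pos h
            rw [Set.mem_preimage, ← this]; exact hx
          · have : q i x = WordT.inf := dif_neg h
            rw [Set.mem_preimage, this] at hx
            exact (hi hx).elim
        · rintro ⟨⟨x, h⟩, hx, rfl⟩
          have : q i x = g ⟨x, h⟩ := dif_pos h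
          rw [Set.mem_preimage, this]; exact hx
      rw [this]
      exact hW.isOpenMap_subtype_val _ (hU.preimage hg)
  have hb : ∀ i x, q i (diskBoundaryInclusion n x) = wval e ((sY.attachMap n i).toFunP x) := by
    intro i x
    have h : 1/2 < ‖(diskBoundaryInclusion n x : EE n)‖ := by rw [norm_bdry]; norm_num
    refine (dif_pos h).trans ?_
    congr 2
    apply Subtype.ext
    change clampFun n ((2 : ℝ) • (x : EE n)) = x
    have hx' : ‖(x : EE n)‖ = 1 := norm_bdry x
    rw [clampFun, norm_smul, hx', Real.norm_of_nonneg (by norm_num), mul_one,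
      max_eq_right (by norm_num), inv_smul_smul₀ (by norm_num)]
  obtain ⟨h, h1, -⟩ := sY.pushout_extend n (wordFlow V) e q hq hb (fun _ _ => rfl) (fun _ _ => rfl)
  exact ⟨h, h1⟩

/-- The trivial word morphism. -/
def trivWord (X : Flow) {V : Type} [TopologicalSpace V] [Zero V] : FlowHom X (wordFlow V) where
  toFun0 := fun _ => ()
  toFunP := fun _ => WordT.word 0 0
  continuous_toFunP := continuous_const
  s_map := fun _ => rfl
  t_map := fun _ => rfl
  comp_map := fun x y h h' => by
    change _ = WordT.mul (WordT.word 0 0) (WordT.word 0 0)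
    rw [WordT.mul_word]
    congr 1

open Classical in
/-- Reading a letter of an `m`-cell. -/
noncomputable def readCell (m : ℕ) (ρ : ℝ) (c : closedDisk m) : WordT (EE m) :=
  if ‖(c : EE m)‖ < ρ then WordT.word 1 (fun _ => (c : EE m))
  else if ‖(c : EE m)‖ = ρ then WordT.inf else WordT.word 0 0

theorem continuous_readCell (m : ℕ) (ρ : ℝ) : Continuous (readCell m ρ) := by
  refine ⟨fun U hU => ?_⟩
  by_cases hi : WordT.inf ∈ U
  · rw [WordT.eq_univ_of_inf hU hi]; exact isOpen_univ
  · have hN : Continuous (fun c : closedDisk m => ‖(c : EE m)‖) := by fun_prop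
    have : readCell m ρ ⁻¹' U =
        ({c : closedDisk m | ‖(c : EE m)‖ < ρ} ∩ (fun c : closedDisk m => WordT.word 1 (fun _ => (c : EE m))) ⁻¹' U)
        ∪ ({c : closedDisk m | ρ < ‖(c : EE m)‖} ∩ (fun _ => WordT.word 0 0) ⁻¹' U) := by
      ext c
      simp only [Set.mem_preimage, Set.mem_union, Set.mem_inter_iff, Set.mem_ofPred_eq, readCell]
      rcases lt_trichotomy ‖(c : EE m)‖ ρ with h | h | h
      · simp [h, h.le.not_gt]
      · simp [h, hi]
      · simp [h, h.le.not_gt, h.ne']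
    rw [this]
    refine ((isOpen_lt hN continuous_const).inter (hU.preimage ?_)).union
      ((isOpen_lt continuous_const hN).inter (hU.preimage continuous_const))
    exact (WordT.continuous_word 1).comp (by fun_prop)

theorem exists_reader (m : ℕ) (ρ : ℝ) (hρ : ρ < 1) : ∃ E : FlowHom Y (wordFlow (EE m)),
    (∀ x, wval E ((sY.incl m).toFunP x) = WordT.word 0 0) ∧
    ∀ i c, wval E ((sY.incl (m+1)).toFunP ((sY.cellMap m i).toFunP c)) = readCell m ρ c := by
  obtain ⟨d, d1, d2⟩ := sY.pushout_extend m (wordFlow (EE m)) (trivWord _) (fun _ => readCell m ρ)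
    (fun _ => continuous_readCell m ρ) (by
      intro i x
      change readCell m ρ (diskBoundaryInclusion m x) = WordT.word 0 0
      simp only [readCell, norm_bdry]
      rw [if_neg hρ.le.not_gt, if_neg hρ.ne']) (fun _ _ => rfl) (fun _ _ => rfl)
  obtain ⟨E, hE, -⟩ := sY.extend_from (m+1) (wordFlow (EE m)) (fun _ _ => True) d trivial (by
    intro n _ e _
    obtain ⟨h, hh⟩ := sY.word_step n e
    exact ⟨h, hh, trivial⟩)
  refine ⟨E, fun x => ?_, fun i c => ?_⟩
  · rw [← sY.incl_ι]
    have h1 := FlowHom.congrP hE ((sY.ι m).toFunP x)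
    have h2 := FlowHom.congrP d1 x
    exact h1.trans h2
  · exact (FlowHom.congrP hE _).trans (d2 i c)

/-- A choice of readers. -/
noncomputable def reader (m : ℕ) (ρ : Set.Ioo (1/2 : ℝ) 1) : FlowHom Y (wordFlow (EE m)) :=
  Classical.choose (sY.exists_reader m ρ ρ.2.2)

theorem reader_incl (m : ℕ) (ρ : Set.Ioo (1/2 : ℝ) 1) (x) :
    wval (sY.reader m ρ) ((sY.incl m).toFunP x) = WordT.word 0 0 :=
  (Classical.choose_spec (sY.exists_reader m ρ ρ.2.2)).1 x

theorem reader_cell (m : ℕ) (ρ : Set.Ioo (1/2 : ℝ) 1) (i c) :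
    wval (sY.reader m ρ) ((sY.incl (m+1)).toFunP ((sY.cellMap m i).toFunP c)) = readCell m ρ c :=
  (Classical.choose_spec (sY.exists_reader m ρ ρ.2.2)).2 i c

theorem finite_bad (m : ℕ) (x : (sY.sk (m+1)).Path) :
    {ρ | wval (sY.reader m ρ) ((sY.incl (m+1)).toFunP x) = WordT.inf}.Finite := by
  refine sY.sk_induction m
    {x | {ρ | wval (sY.reader m ρ) ((sY.incl (m+1)).toFunP x) = WordT.inf}.Finite} ?_ ?_ ?_ x
  · intro x hx y hy h
    refine (Set.Finite.union hx hy).subset ?_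
    intro ρ hρ
    have h' := (sY.incl (m+1)).composable h
    simp only [Set.mem_ofPred_eq] at hρ
    rw [(sY.incl (m+1)).comp_map x y h h', wval_comp] at hρ
    simp only [Set.mem_union, Set.mem_ofPred_eq]
    generalize wval (sY.reader m ρ) ((sY.incl (m+1)).toFunP x) = a at *
    generalize wval (sY.reader m ρ) ((sY.incl (m+1)).toFunP y) = b at *
    cases a with
    | inf => exact Or.inl rfl
    | word k f =>
      cases b with
      | inf => exact Or.inr rfl
      | word l g => cases hρ
  · intro x
    simp only [Set.mem_ofPred_eq]
    convert Set.finite_empty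
    ext ρ
    rw [Set.mem_ofPred_eq, sY.incl_ι, reader_incl]
    simp
  · intro i c
    change closedDisk m at c
    refine Set.Finite.subset (Set.Finite.preimage (f := Subtype.val)
      (Subtype.val_injective.injOn) (Set.finite_singleton ‖(c : EE m)‖)) ?_
    intro ρ hρ
    replace hρ : readCell m ρ c = WordT.inf := (sY.reader_cell m ρ i c).symm.trans hρ
    unfold readCell at hρ
    split_ifs at hρ with h1 h2
    exact h2.symm

theorem exists_good (m : ℕ) (y : Y.Path) (hy : y ∈ sY.R (m+1)) :
    ∃ ρ k f, wval (sY.reader m ρ) y = WordT.word k f := by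
  obtain ⟨x, rfl⟩ := hy
  haveI : Infinite (Set.Ioo (1/2 : ℝ) 1) := (Set.Ioo_infinite (by norm_num)).to_subtype
  obtain ⟨ρ, hρ⟩ := (sY.finite_bad m x).exists_notMem
  refine ⟨ρ, ?_⟩
  simp only [Set.mem_ofPred_eq] at hρ
  generalize wval (sY.reader m ρ) ((sY.incl (m+1)).toFunP x) = a at *
  cases a with
  | inf => exact (hρ rfl).elim
  | word k f => exact ⟨k, f, rfl⟩

/-- Finitely many branch functions describe all letters of a compact family. -/
theorem branches (m n : ℕ) (φ : closedDisk n → Y.Path) (hφ : Continuous φ)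
    (hR : ∀ z, φ z ∈ sY.R (m+1)) : ∃ F : List C(closedDisk n, EE m), ∀ z, ∃ ρ k f,
      wval (sY.reader m ρ) (φ z) = WordT.word k f ∧ ∀ j < k, ∃ c ∈ F, f j = c z := by
  have := isCompact_univ (X := closedDisk n).induction_on
    (p := fun s => ∃ F : List C(closedDisk n, EE m), ∀ z ∈ s, ∃ ρ k f,
      wval (sY.reader m ρ) (φ z) = WordT.word k f ∧ ∀ j < k, ∃ c ∈ F, f j = c z) ?_ ?_ ?_ ?_
  · obtain ⟨F, hF⟩ := this
    exact ⟨F, fun z => hF z (Set.mem_univ z)⟩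
  · exact ⟨[], fun z hz => hz.elim⟩
  · rintro s t hst ⟨F, hF⟩
    exact ⟨F, fun z hz => hF z (hst hz)⟩
  · rintro s t ⟨F, hF⟩ ⟨F', hF'⟩
    refine ⟨F ++ F', ?_⟩
    rintro z (hz | hz)
    · obtain ⟨ρ, k, f, h1, h2⟩ := hF z hz
      refine ⟨ρ, k, f, h1, fun j hj => ?_⟩
      obtain ⟨c, hc, e⟩ := h2 j hj
      exact ⟨c, List.mem_append_left _ hc, e⟩
    · obtain ⟨ρ, k, f, h1, h2⟩ := hF' z hz
      refine ⟨ρ, k, f, h1, fun j hj => ?_⟩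
      obtain ⟨c, hc, e⟩ := h2 j hj
      exact ⟨c, List.mem_append_right _ hc, e⟩
  · intro z0 _
    obtain ⟨ρ, k, f0, h0⟩ := sY.exists_good m (φ z0) (hR z0)
    have hψ : Continuous (fun z => wval (sY.reader m ρ) (φ z)) := (continuous_wval _).comp hφ
    have hW : (fun z => wval (sY.reader m ρ) (φ z)) ⁻¹' (Set.range (WordT.word k)) ∈ 𝓝 z0 := by
      refine IsOpen.mem_nhds (IsOpen.preimage hψ ?_) ⟨f0, h0.symm⟩
      rw [← Set.image_univ]; exact WordT.isOpenMap_word k _ isOpen_univ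
    obtain ⟨C, hC0, hCc, hCW⟩ := exists_mem_nhds_isClosed_subset hW
    have hco : Continuous (fun z : C => WordT.coords 0 (wval (sY.reader m ρ) (φ z))) := by
      refine (WordT.continuousOn_coords (0 : ℕ → EE m) k).comp_continuous
        (hψ.comp continuous_subtype_val) (fun z => hCW z.2)
    haveI : TietzeExtension (EE m) := TietzeExtension.of_tvs ℝ
    have hext : ∀ j : ℕ, ∃ g : C(closedDisk n, EE m), ∀ z : C,
        g z = WordT.coords 0 (wval (sY.reader m ρ) (φ z)) j := by
      intro j
      obtain ⟨g, hg⟩ := ContinuousMap.exists_restrict_eq hCc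
        (⟨fun z : C => WordT.coords 0 (wval (sY.reader m ρ) (φ z)) j,
          (continuous_apply j).comp hco⟩ : C(C, EE m))
      exact ⟨g, fun z => congrArg (fun h : C(C, EE m) => h z) hg⟩
    choose g hg using hext
    refine ⟨C, mem_nhdsWithin_of_mem_nhds hC0, (List.range k).map g, fun z hz => ?_⟩
    obtain ⟨f, hf⟩ := hCW hz
    refine ⟨ρ, k, f, hf.symm, fun j hj => ⟨g j, List.mem_map.2 ⟨j, List.mem_range.2 hj, rfl⟩, ?_⟩⟩
    rw [hg j ⟨z, hz⟩]
    simp only at hf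
    simp only [← hf, WordT.coords]

end SCofibrantStructure

open scoped Topology

/-! ### Extending homotopies over cells, and compression by one dimension -/

theorem s_const_of_path {W : Flow} (F : unitInterval → W.Path) (hF : Continuous F)
    (u u' : unitInterval) : W.s (F u) = W.s (F u') :=
  PreconnectedSpace.constant inferInstance (W.continuous_s.comp hF)

theorem t_const_of_path {W : Flow} (F : unitInterval → W.Path) (hF : Continuous F)
    (u u' : unitInterval) : W.t (F u) = W.t (F u') :=
  PreconnectedSpace.constant inferInstance (W.continuous_t.comp hF)

namespace SCofibrantStructure

variable {Y : Flow} (sY : SCofibrantStructure Y)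

theorem incl_ι_state (n : ℕ) (x : (sY.sk n).State) :
    (sY.incl (n+1)).toFun0 ((sY.ι n).toFun0 x) = (sY.incl n).toFun0 x :=
  FlowHom.congr0 (sY.incl_comm n) x

theorem incl_cell_attach (n : ℕ) (i : sY.cells n) (x : diskBoundary n) :
    (sY.incl (n+1)).toFunP ((sY.cellMap n i).toFunP (diskBoundaryInclusion n x)) =
      (sY.incl n).toFunP ((sY.attachMap n i).toFunP x) := by
  rw [sY.cell_bdry, sY.incl_ι]

/-- Extension of a homotopy over the `k`-cells, with prescribed values. -/
theorem cellStep {W : Flow} (B : FlowHom Y W) (k : ℕ) (e : FlowHom (sY.sk k) (PF W unitInterval))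
    (he : (PF.ev (Z := W) (0 : unitInterval)).comp e = B.comp (sY.incl k))
    (F : sY.cells k → closedDisk k → unitInterval → W.Path)
    (hF : ∀ i, Continuous (fun p : closedDisk k × unitInterval => F i p.1 p.2))
    (hF0 : ∀ i x, F i x 0 = B.toFunP ((sY.incl (k+1)).toFunP ((sY.cellMap k i).toFunP x)))
    (hFb : ∀ i x u, F i (diskBoundaryInclusion k x) u =
      (PF.ev (Z := W) u).toFunP (e.toFunP ((sY.attachMap k i).toFunP x))) :
    ∃ e' : FlowHom (sY.sk (k+1)) (PF W unitInterval), e'.comp (sY.ι k) = e ∧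
      (PF.ev (Z := W) (0 : unitInterval)).comp e' = B.comp (sY.incl (k+1)) ∧
      ∀ i (x : closedDisk k) u, (PF.ev (Z := W) u).toFunP (e'.toFunP ((sY.cellMap k i).toFunP x)) = F i x u := by
  have hst : ∀ a, e.toFun0 a = B.toFun0 ((sY.incl k).toFun0 a) := fun a => FlowHom.congr0 he a
  have hs0 : ∀ i x u, W.s (F i x u) = e.toFun0 ((sY.attachMap k i).toFun0 (0 : Fin 2)) := by
    intro i x u
    rw [s_const_of_path (F i x) ((hF i).comp (Continuous.prodMk_right x)) u 0, hF0, B.s_map,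
      (sY.incl (k+1)).s_map, sY.s_cell, sY.incl_ι_state, hst]
  have ht0 : ∀ i x u, W.t (F i x u) = e.toFun0 ((sY.attachMap k i).toFun0 (1 : Fin 2)) := by
    intro i x u
    rw [t_const_of_path (F i x) ((hF i).comp (Continuous.prodMk_right x)) u 0, hF0, B.t_map,
      (sY.incl (k+1)).t_map, sY.t_cell, sY.incl_ι_state, hst]
  obtain ⟨e', h1, h2⟩ := sY.pushout_extend k (PF W unitInterval) e
    (fun i x => PF.mk _ _ (F i x) ((hF i).comp (Continuous.prodMk_right x)) (hs0 i x) (ht0 i x))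
    (fun i => PF.continuous_mk _ _ (F i) (hF i) (hs0 i) (ht0 i))
    (by
      intro i x
      refine PF.ext ?_ ?_ ?_
      · exact ((e.s_map _).trans (congrArg e.toFun0 ((sY.attachMap k i).s_map x))).symm
      · exact ((e.t_map _).trans (congrArg e.toFun0 ((sY.attachMap k i).t_map x))).symm
      · intro u
        exact hFb i x u)
    (fun i x => rfl) (fun i x => rfl)
  have h3 : ∀ i (x : closedDisk k) u,
      (PF.ev (Z := W) u).toFunP (e'.toFunP ((sY.cellMap k i).toFunP x)) = F i x u := by
    intro i x u
    exact congrArg (PF.ev (Z := W) u).toFunP (h2 i x)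
  refine ⟨e', h1, ?_, h3⟩
  apply sY.pushout_unique
  · rw [FlowHom.comp_assoc, h1, he, FlowHom.comp_assoc, sY.incl_comm]
  · intro i
    refine FlowHom.ext (funext fun a => ?_) (funext fun x => ?_)
    · change e'.toFun0 ((sY.cellMap k i).toFun0 a) =
        B.toFun0 ((sY.incl (k+1)).toFun0 ((sY.cellMap k i).toFun0 a))
      rw [sY.cell_state k i a]
      have := FlowHom.congr0 h1 ((sY.attachMap k i).toFun0 a)
      refine (this.trans (hst _)).trans ?_
      rw [sY.incl_ι_state]
    · exact (h3 i x 0).trans (hF0 i x)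

/-- Extension of a homotopy over the `k`-cells. -/
theorem hepStep {W : Flow} (B : FlowHom Y W) (k : ℕ) (e : FlowHom (sY.sk k) (PF W unitInterval))
    (he : (PF.ev (Z := W) (0 : unitInterval)).comp e = B.comp (sY.incl k)) :
    ∃ e' : FlowHom (sY.sk (k+1)) (PF W unitInterval), e'.comp (sY.ι k) = e ∧
      (PF.ev (Z := W) (0 : unitInterval)).comp e' = B.comp (sY.incl (k+1)) := by
  have : ∀ i, ∃ F : closedDisk k → unitInterval → W.Path,
      Continuous (fun p : closedDisk k × unitInterval => F p.1 p.2) ∧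
      (∀ x, F x 0 = B.toFunP ((sY.incl (k+1)).toFunP ((sY.cellMap k i).toFunP x))) ∧
      (∀ x u, F (diskBoundaryInclusion k x) u =
        (PF.ev (Z := W) u).toFunP (e.toFunP ((sY.attachMap k i).toFunP x))) := by
    intro i
    obtain ⟨F, h1, h2, h3, -, -⟩ := hep k
      (fun x => B.toFunP ((sY.incl (k+1)).toFunP ((sY.cellMap k i).toFunP x)))
      (B.continuous_toFunP.comp ((sY.incl (k+1)).continuous_toFunP.comp
        (sY.cellMap k i).continuous_toFunP))
      (fun x u => (PF.ev (Z := W) u).toFunP (e.toFunP ((sY.attachMap k i).toFunP x)))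
      (PF.continuous_ev.comp (Continuous.prodMk (e.continuous_toFunP.comp
        ((sY.attachMap k i).continuous_toFunP.comp continuous_fst)) continuous_snd))
      (by
        intro x
        refine (FlowHom.congrP he ((sY.attachMap k i).toFunP x)).trans ?_
        exact congrArg B.toFunP (sY.incl_cell_attach k i x).symm)
    exact ⟨F, h1, h2, h3⟩
  choose F h1 h2 h3 using this
  obtain ⟨e', a, b, -⟩ := sY.cellStep B k e he F h1 h2 h3
  exact ⟨e', a, b⟩

/-- The characteristic map of a cell, as a map to the paths of `Y`. -/
def cellP (m : ℕ) (i : sY.cells m) (c : closedDisk m) : Y.Path :=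
  (sY.incl (m+1)).toFunP ((sY.cellMap m i).toFunP c)

theorem continuous_cellP (m : ℕ) (i : sY.cells m) : Continuous (sY.cellP m i) :=
  (sY.incl (m+1)).continuous_toFunP.comp (sY.cellMap m i).continuous_toFunP

theorem s_cellP (m : ℕ) (i : sY.cells m) (c : closedDisk m) :
    Y.s (sY.cellP m i c) = (sY.incl m).toFun0 ((sY.attachMap m i).toFun0 (0 : Fin 2)) := by
  rw [cellP, (sY.incl (m+1)).s_map, sY.s_cell, sY.incl_ι_state]

theorem t_cellP (m : ℕ) (i : sY.cells m) (c : closedDisk m) :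
    Y.t (sY.cellP m i c) = (sY.incl m).toFun0 ((sY.attachMap m i).toFun0 (1 : Fin 2)) := by
  rw [cellP, (sY.incl (m+1)).t_map, sY.t_cell, sY.incl_ι_state]

theorem continuous_pushCell (n m : ℕ) (v : C(closedDisk n, EE m)) (ε : ℝ) (i : sY.cells m) :
    Continuous (fun p : (closedDisk m × unitInterval) × closedDisk n =>
      sY.cellP m i (push v ε p.2 p.1.2 p.1.1)) :=
  (sY.continuous_cellP m i).comp ((continuous_push v ε).comp
    (f := fun p : (closedDisk m × unitInterval) × closedDisk n =>
      (p.2, p.1.2, p.1.1)) (by fun_prop))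

theorem continuous_pushCell_fixed (n m : ℕ) (v : C(closedDisk n, EE m)) (ε : ℝ) (i : sY.cells m)
    (c : closedDisk m) (u : unitInterval) :
    Continuous (fun z : closedDisk n => sY.cellP m i (push v ε z u c)) :=
  (sY.continuous_cellP m i).comp ((continuous_push v ε).comp
    (f := fun z : closedDisk n => (z, u, c)) (by fun_prop))

/-- The family of pushed cells. -/
noncomputable def pushF (n m : ℕ) (v : C(closedDisk n, EE m)) (ε : ℝ) (i : sY.cells m) (c : closedDisk m)
    (u : unitInterval) : (PF Y (closedDisk n)).Path :=
  PF.mk ((sY.incl m).toFun0 ((sY.attachMap m i).toFun0 (0 : Fin 2)))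
    ((sY.incl m).toFun0 ((sY.attachMap m i).toFun0 (1 : Fin 2)))
    (fun z : closedDisk n => sY.cellP m i (push v ε z u c))
      (sY.continuous_pushCell_fixed n m v ε i c u)
      (fun z => sY.s_cellP m i (push v ε z u c)) (fun z => sY.t_cellP m i (push v ε z u c))

theorem ev_pushF (n m : ℕ) (v : C(closedDisk n, EE m)) (ε : ℝ) (i : sY.cells m) (c : closedDisk m)
    (u : unitInterval) (z : closedDisk n) :
    (PF.ev (Z := Y) z).toFunP (sY.pushF n m v ε i c u) = sY.cellP m i (push v ε z u c) := rfl

theorem s_pushF (n m : ℕ) (v : C(closedDisk n, EE m)) (ε : ℝ) (i : sY.cells m) (c : closedDisk m)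
    (u : unitInterval) : (PF Y (closedDisk n)).s (sY.pushF n m v ε i c u) =
      (sY.incl m).toFun0 ((sY.attachMap m i).toFun0 (0 : Fin 2)) := rfl

theorem t_pushF (n m : ℕ) (v : C(closedDisk n, EE m)) (ε : ℝ) (i : sY.cells m) (c : closedDisk m)
    (u : unitInterval) : (PF Y (closedDisk n)).t (sY.pushF n m v ε i c u) =
      (sY.incl m).toFun0 ((sY.attachMap m i).toFun0 (1 : Fin 2)) := rfl

theorem continuous_pushF (n m : ℕ) (v : C(closedDisk n, EE m)) (ε : ℝ) (i : sY.cells m) :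
    Continuous (fun p : closedDisk m × unitInterval => sY.pushF n m v ε i p.1 p.2) :=
  PF.continuous_mk ((sY.incl m).toFun0 ((sY.attachMap m i).toFun0 (0 : Fin 2)))
    ((sY.incl m).toFun0 ((sY.attachMap m i).toFun0 (1 : Fin 2)))
    (fun (p : closedDisk m × unitInterval) (z : closedDisk n) =>
      sY.cellP m i (push v ε z p.2 p.1)) (sY.continuous_pushCell n m v ε i)
      (fun p z => sY.s_cellP m i (push v ε z p.2 p.1))
      (fun p z => sY.t_cellP m i (push v ε z p.2 p.1))

theorem pushF_zero (n m : ℕ) (v : C(closedDisk n, EE m)) (ε : ℝ) (i : sY.cells m)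
    (x : closedDisk m) : sY.pushF n m v ε i x 0 =
      (PF.const Y (closedDisk n)).toFunP ((sY.incl (m+1)).toFunP ((sY.cellMap m i).toFunP x)) := by
  refine PF.ext (sY.s_cellP m i x).symm (sY.t_cellP m i x).symm fun z => ?_
  change sY.cellP m i (push v ε z 0 x) = sY.cellP m i x
  rw [push_zero]

theorem pushF_bdry (n m : ℕ) (v : C(closedDisk n, EE m)) (ε : ℝ) (i : sY.cells m)
    (x : diskBoundary m) (u : unitInterval) : sY.pushF n m v ε i (diskBoundaryInclusion m x) u =
      (PF.const Y (closedDisk n)).toFunP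
        ((sY.incl m).toFunP ((sY.attachMap m i).toFunP x)) := by
  have e : sY.cellP m i (diskBoundaryInclusion m x) =
    (sY.incl m).toFunP ((sY.attachMap m i).toFunP x) := sY.incl_cell_attach m i x
  rw [← e]
  refine PF.ext (sY.s_cellP m i _).symm (sY.t_cellP m i _).symm fun z => ?_
  change sY.cellP m i (push v ε z u (diskBoundaryInclusion m x)) =
    sY.cellP m i (diskBoundaryInclusion m x)
  rw [push_bdry _ _ _ _ _ (norm_bdry x)]

theorem exists_push_cells (n m : ℕ) (v : C(closedDisk n, EE m)) (ε : ℝ) :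
    ∃ d : FlowHom (sY.sk (m+1)) (PF (PF Y (closedDisk n)) unitInterval),
      d.comp (sY.ι m) = (PF.const (PF Y (closedDisk n)) unitInterval).comp
        ((PF.const Y (closedDisk n)).comp (sY.incl m)) ∧
      (PF.ev (Z := PF Y (closedDisk n)) (0 : unitInterval)).comp d =
        (PF.const Y (closedDisk n)).comp (sY.incl (m+1)) ∧
      ∀ i (x : closedDisk m) u, (PF.ev (Z := PF Y (closedDisk n)) u).toFunP
        (d.toFunP ((sY.cellMap m i).toFunP x)) = sY.pushF n m v ε i x u :=
  sY.cellStep (PF.const Y (closedDisk n)) m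
    ((PF.const (PF Y (closedDisk n)) unitInterval).comp
      ((PF.const Y (closedDisk n)).comp (sY.incl m)))
    (FlowHom.ext rfl rfl) (sY.pushF n m v ε)
    (sY.continuous_pushF n m v ε) (sY.pushF_zero n m v ε) (sY.pushF_bdry n m v ε)

/-- The deformation of `Y` pushing `m`-cells off their moving centres. -/
theorem exists_push (n m : ℕ) (v : C(closedDisk n, EE m)) (ε : ℝ) :
    ∃ G : FlowHom Y (PF (PF Y (closedDisk n)) unitInterval),
      (∀ x z u, (PF.ev (Z := Y) z).toFunP ((PF.ev (Z := PF Y (closedDisk n)) u).toFunP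
        (G.toFunP ((sY.incl m).toFunP x))) = (sY.incl m).toFunP x) ∧
      (∀ x z, (PF.ev (Z := Y) z).toFunP ((PF.ev (Z := PF Y (closedDisk n)) 0).toFunP
        (G.toFunP ((sY.incl (m+1)).toFunP x))) = (sY.incl (m+1)).toFunP x) ∧
      (∀ i (c : closedDisk m) z u, (PF.ev (Z := Y) z).toFunP ((PF.ev (Z := PF Y (closedDisk n)) u).toFunP
        (G.toFunP ((sY.incl (m+1)).toFunP ((sY.cellMap m i).toFunP c)))) =
          (sY.incl (m+1)).toFunP ((sY.cellMap m i).toFunP (push v ε z u c))) := by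
  obtain ⟨d, d1, d2, d3⟩ := sY.exists_push_cells n m v ε
  obtain ⟨G, G1, -⟩ := sY.extend_from (m+1) (PF (PF Y (closedDisk n)) unitInterval)
    (fun k e => (PF.ev (Z := PF Y (closedDisk n)) (0 : unitInterval)).comp e =
      (PF.const Y (closedDisk n)).comp (sY.incl k)) d d2
    (fun k _ e he => sY.hepStep (PF.const Y (closedDisk n)) k e he)
  have hG : ∀ x, G.toFunP ((sY.incl (m+1)).toFunP x) = d.toFunP x := fun x => FlowHom.congrP G1 x
  refine ⟨G, ?_, ?_, ?_⟩
  · intro x z u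
    have h := (congrArg G.toFunP (sY.incl_ι m x).symm).trans
      ((hG _).trans (FlowHom.congrP d1 x))
    exact congrArg (fun q => (PF.ev (Z := Y) z).toFunP
      ((PF.ev (Z := PF Y (closedDisk n)) u).toFunP q)) h
  · intro x z
    have h := (congrArg (PF.ev (Z := PF Y (closedDisk n)) (0 : unitInterval)).toFunP
      (hG x)).trans (FlowHom.congrP d2 x)
    exact congrArg (PF.ev (Z := Y) z).toFunP h
  · intro i c z u
    have h := (congrArg (PF.ev (Z := PF Y (closedDisk n)) u).toFunP (hG _)).trans (d3 i c u)
    exact congrArg (PF.ev (Z := Y) z).toFunP h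

theorem compressStep (n m : ℕ) (hnm : n < m) (φ : closedDisk n → Y.Path) (hφ : Continuous φ)
    (hR : ∀ z, φ z ∈ sY.R (m+1)) : ∃ K : closedDisk n → unitInterval → Y.Path,
      Continuous (fun p : closedDisk n × unitInterval => K p.1 p.2) ∧ (∀ z, K z 0 = φ z) ∧
      (∀ z u, φ z ∈ sY.R m → K z u = φ z) ∧ ∀ z, K z 1 ∈ sY.R m := by
  obtain ⟨L, hL⟩ := sY.branches m n φ hφ hR
  obtain ⟨v, ε, hε, hv, hvL⟩ := exists_avoid hnm L (1/4) (by norm_num)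
  obtain ⟨G, G1, G2, G3⟩ := sY.exists_push n m v ε
  refine ⟨fun z u => (PF.ev (Z := Y) z).toFunP ((PF.ev (Z := PF Y (closedDisk n)) u).toFunP
        (G.toFunP (φ z))), ?_, ?_, ?_, ?_⟩
  · refine PF.continuous_ev.comp (Continuous.prodMk ?_ continuous_fst)
    exact PF.continuous_ev.comp (Continuous.prodMk (G.continuous_toFunP.comp
      (hφ.comp continuous_fst)) continuous_snd)
  · intro z
    obtain ⟨x, hx⟩ := hR z
    beta_reduce
    rw [← hx]; exact G2 x z
  · rintro z u ⟨x, hx⟩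
    beta_reduce
    rw [← hx]; exact G1 x z u
  · intro z
    obtain ⟨ρ, k, f, h1, h2⟩ := hL z
    obtain ⟨x, hx⟩ := hR z
    let Γ : FlowHom Y Y := (PF.ev (Z := Y) z).comp
      ((PF.ev (Z := PF Y (closedDisk n)) (1 : unitInterval)).comp G)
    have key : ∀ x : (sY.sk (m+1)).Path, x ∈ {x : (sY.sk (m+1)).Path | ∀ k f,
        wval (sY.reader m ρ) ((sY.incl (m+1)).toFunP x) = WordT.word k f →
        (∀ j < k, ε ≤ ‖v z - f j‖) → Γ.toFunP ((sY.incl (m+1)).toFunP x) ∈ sY.R m} := by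
      apply sY.sk_induction
      · intro x hx y hy h k f hw hf
        have h' := (sY.incl (m+1)).composable h
        rw [(sY.incl (m+1)).comp_map x y h h'] at hw ⊢
        rw [wval_comp] at hw
        rw [Γ.comp_map _ _ h' (Γ.composable h')]
        cases hwx : wval (sY.reader m ρ) ((sY.incl (m+1)).toFunP x) with
        | inf => rw [hwx] at hw; cases hw
        | word k1 f1 =>
          cases hwy : wval (sY.reader m ρ) ((sY.incl (m+1)).toFunP y) with
          | inf => rw [hwx, hwy] at hw; cases hw
          | word k2 f2 =>
            rw [hwx, hwy, WordT.mul_word] at hw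
            injection hw with e1 e2
            refine sY.R_comp m _ (hx k1 f1 hwx ?_) _ (hy k2 f2 hwy ?_) _
            · intro j hj
              have := hf j (by omega)
              rwa [← e2, WordT.cat, if_pos hj] at this
            · intro j hj
              have := hf (k1 + j) (by omega)
              rwa [← e2, WordT.cat, if_neg (by omega), Nat.add_sub_cancel_left] at this
      · intro x k f _ _
        rw [sY.incl_ι]
        exact ⟨x, (G1 x z 1).symm⟩
      · intro i c k f hw hf
        have hw' : readCell m ρ c = WordT.word k f := (sY.reader_cell m ρ i c).symm.trans hw
        have e : Γ.toFunP ((sY.incl (m+1)).toFunP ((sY.cellMap m i).toFunP c)) =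
          (sY.incl (m+1)).toFunP ((sY.cellMap m i).toFunP (push v ε z 1 c)) := G3 i c z 1
        rw [e]
        apply sY.incl_cell_bdry
        apply push_one v ε hε hv
        unfold readCell at hw'
        split_ifs at hw' with h1 h2
        · right
          injection hw' with e1 e2
          have := hf 0 (by omega)
          rwa [← e2] at this
        · left
          have := ρ.2.1
          push Not at h1
          linarith
    have := key x k f (by rw [hx]; exact h1) (by
      intro j hj
      obtain ⟨c, hc, e⟩ := h2 j hj
      rw [e]; exact hvL c hc z)
    rw [hx] at this
    exact this

end SCofibrantStructure

open scoped Topology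

/-! ### Compression and the cellular approximation theorem -/

/-- Concatenation of two homotopies, with a variable amount `κ` of the second one. -/
theorem glue_homotopies {A P : Type} [TopologicalSpace A] [TopologicalSpace P]
    (F K : A → unitInterval → P) (hF : Continuous (fun p : A × unitInterval => F p.1 p.2))
    (hK : Continuous (fun p : A × unitInterval => K p.1 p.2)) (hFK : ∀ x, F x 1 = K x 0)
    (κ : A → unitInterval) (hκ : Continuous κ) :
    ∃ H : A → unitInterval → P, Continuous (fun p : A × unitInterval => H p.1 p.2) ∧
      (∀ x, H x 0 = F x 0) ∧ (∀ x u, κ x = 0 → H x u = F x u) ∧ (∀ x, H x 1 = K x (κ x)) ∧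
      (∀ x u, (∃ u', H x u = F x u') ∨ ∃ u', H x u = K x u') := by
  classical
  let w : A × unitInterval → ℝ := fun p => (p.2 : ℝ) * (1 + (κ p.1 : ℝ))
  have hw : Continuous w := by fun_prop
  let P1 : ℝ → unitInterval := Set.projIcc 0 1 zero_le_one
  have hP1 : Continuous P1 := continuous_projIcc
  refine ⟨fun x u => if w (x, u) ≤ 1 then F x (P1 (w (x, u))) else K x (P1 (w (x, u) - 1)),
    ?_, ?_, ?_, ?_, ?_⟩
  · refine Continuous.if_le (f := w) (g := fun _ => 1)
      (f' := fun p : A × unitInterval => F p.1 (P1 (w p)))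
      (g' := fun p : A × unitInterval => K p.1 (P1 (w p - 1))) ?_ ?_ hw continuous_const ?_
    · exact hF.comp (continuous_fst.prodMk (hP1.comp hw))
    · exact hK.comp (continuous_fst.prodMk (hP1.comp (hw.sub continuous_const)))
    · intro p hp
      have e1 : P1 1 = 1 := Set.projIcc_right zero_le_one
      have e0 : P1 0 = 0 := Set.projIcc_left zero_le_one
      rw [hp, sub_self, e1, e0, hFK]
  · intro x
    have e : w (x, 0) = 0 := by simp [w]
    have e0 : P1 0 = 0 := Set.projIcc_left zero_le_one
    beta_reduce
    rw [e, if_pos zero_le_one, e0]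
  · intro x u h
    have e : w (x, u) = u := by simp [w, h]
    have e0 : P1 u = u := Set.projIcc_val zero_le_one u
    beta_reduce
    rw [e, if_pos u.2.2, e0]
  · intro x
    have e : w (x, 1) = 1 + κ x := by simp [w]
    have e1 : P1 1 = 1 := Set.projIcc_right zero_le_one
    beta_reduce
    rw [e]
    split_ifs with h
    · have h0 : κ x = 0 := Subtype.ext (le_antisymm (by simpa using h) (κ x).2.1)
      rw [h0, ← hFK]
      simp [e1]
    · rw [add_sub_cancel_left]
      have e0 : P1 (κ x) = κ x := Set.projIcc_val zero_le_one _
      rw [e0]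
  · intro x u
    beta_reduce
    split_ifs with h
    · exact Or.inl ⟨_, rfl⟩
    · exact Or.inr ⟨_, rfl⟩

namespace SCofibrantStructure

theorem compress_aux {Y : Flow} (sY : SCofibrantStructure Y) (n j : ℕ) :
    ∀ (φ : closedDisk n → Y.Path), Continuous φ → (∀ z, φ z ∈ sY.R (n+1+j)) →
    ∃ K : closedDisk n → unitInterval → Y.Path,
      Continuous (fun p : closedDisk n × unitInterval => K p.1 p.2) ∧ (∀ z, K z 0 = φ z) ∧
      (∀ z u, φ z ∈ sY.R (n+1) → K z u = φ z) ∧ ∀ z, K z 1 ∈ sY.R (n+1) := by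
  induction j with
  | zero =>
    intro φ hφ hR
    exact ⟨fun z _ => φ z, hφ.comp continuous_fst, fun _ => rfl, fun _ _ _ => rfl, hR⟩
  | succ j ih =>
    intro φ hφ hR
    obtain ⟨F, F1, F2, F3, F4⟩ := sY.compressStep n (n+1+j) (by omega) φ hφ hR
    obtain ⟨K, K1, K2, K3, K4⟩ := ih (fun z => F z 1)
      (F1.comp (continuous_id.prodMk continuous_const)) F4
    obtain ⟨H, H1, H2, -, H4, H5⟩ := glue_homotopies F K F1 K1 (fun x => (K2 x).symm)
      (fun _ => 1) continuous_const
    refine ⟨H, H1, fun z => (H2 z).trans (F2 z), ?_, fun z => ?_⟩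
    · intro z u hz
      have hF : ∀ u, F z u = φ z := fun u => F3 z u (sY.R_mono (by omega) hz)
      rcases H5 z u with ⟨u', h⟩ | ⟨u', h⟩
      · rw [h, hF]
      · rw [h, K3 z u' (by rw [hF]; exact hz), hF]
    · rw [H4]; exact K4 z

theorem compress {Y : Flow} (sY : SCofibrantStructure Y) (n : ℕ) (φ : closedDisk n → Y.Path)
    (hφ : Continuous φ) :
    ∃ K : closedDisk n → unitInterval → Y.Path,
      Continuous (fun p : closedDisk n × unitInterval => K p.1 p.2) ∧ (∀ z, K z 0 = φ z) ∧
      (∀ z u, φ z ∈ sY.R (n+1) → K z u = φ z) ∧ ∀ z, K z 1 ∈ sY.R (n+1) := by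
  obtain ⟨N, hN⟩ := sY.exists_skeleton φ hφ
  exact sY.compress_aux n N φ hφ (fun z => sY.R_mono (by omega) (hN z))

/-- The cut-off function equal to `0` on the boundary and to `1` on the ball of radius `3/4`. -/
noncomputable def cutoff (n : ℕ) (x : closedDisk n) : unitInterval :=
  Set.projIcc 0 1 zero_le_one (4 * (1 - ‖(x : EE n)‖))

theorem continuous_cutoff (n : ℕ) : Continuous (cutoff n) := by
  unfold cutoff
  exact continuous_projIcc.comp (by fun_prop)

theorem cutoff_bdry (n : ℕ) (x : diskBoundary n) : cutoff n (diskBoundaryInclusion n x) = 0 := by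
  unfold cutoff
  rw [norm_bdry, sub_self, mul_zero]
  exact Set.projIcc_left zero_le_one

theorem cutoff_one (n : ℕ) (x : closedDisk n) (h : ‖(x : EE n)‖ ≤ 3/4) : cutoff n x = 1 := by
  unfold cutoff
  exact Set.projIcc_of_right_le _ (by linarith)

theorem cell_homotopy {Y : Flow} (sY : SCofibrantStructure Y) (n : ℕ) (c : closedDisk n → Y.Path)
    (hc : Continuous c) (b : diskBoundary n → unitInterval → Y.Path)
    (hb : Continuous (fun p : diskBoundary n × unitInterval => b p.1 p.2))
    (hbc : ∀ x, b x 0 = c (diskBoundaryInclusion n x)) (hb1 : ∀ x, b x 1 ∈ sY.R n) :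
    ∃ F : closedDisk n → unitInterval → Y.Path,
      Continuous (fun p : closedDisk n × unitInterval => F p.1 p.2) ∧
      (∀ x, F x 0 = c x) ∧ (∀ x u, F (diskBoundaryInclusion n x) u = b x u) ∧
      ∀ x, F x 1 ∈ sY.R (n+1) := by
  obtain ⟨F, F1, F2, F3, F4, -⟩ := hep n c hc b hb hbc
  obtain ⟨K, K1, K2, K3, K4⟩ := sY.compress n (fun z => F z 1)
    (F1.comp (continuous_id.prodMk continuous_const))
  obtain ⟨H, H1, H2, H3, H4, -⟩ := glue_homotopies F K F1 K1 (fun x => (K2 x).symm)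
    (cutoff n) (continuous_cutoff n)
  refine ⟨H, H1, fun x => (H2 x).trans (F2 x), fun x u => ?_, fun x => ?_⟩
  · rw [H3 _ _ (cutoff_bdry n x), F3]
  · rw [H4]
    rcases le_total ‖(x : EE n)‖ (3/4) with h | h
    · rw [cutoff_one n x h]; exact K4 x
    · obtain ⟨x', hx'⟩ := F4 x h
      have : F x 1 ∈ sY.R (n+1) := by
        rw [hx']; exact sY.R_mono (Nat.le_succ n) (hb1 x')
      rw [K3 x _ this]; exact this

theorem main_step {X Y : Flow} (sX : SCofibrantStructure X) (sY : SCofibrantStructure Y)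
    (f : FlowHom X Y) (n : ℕ) (e : FlowHom (sX.sk n) (PF Y unitInterval))
    (he : (PF.ev (Z := Y) (0 : unitInterval)).comp e = f.comp (sX.incl n))
    (he1 : ∀ x, (PF.ev (Z := Y) (1 : unitInterval)).toFunP (e.toFunP x) ∈ sY.R n) :
    ∃ e' : FlowHom (sX.sk (n+1)) (PF Y unitInterval), e'.comp (sX.ι n) = e ∧
      (PF.ev (Z := Y) (0 : unitInterval)).comp e' = f.comp (sX.incl (n+1)) ∧
      ∀ x, (PF.ev (Z := Y) (1 : unitInterval)).toFunP (e'.toFunP x) ∈ sY.R (n+1) := by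
  have : ∀ i, ∃ F : closedDisk n → unitInterval → Y.Path,
      Continuous (fun p : closedDisk n × unitInterval => F p.1 p.2) ∧
      (∀ x, F x 0 = f.toFunP ((sX.incl (n+1)).toFunP ((sX.cellMap n i).toFunP x))) ∧
      (∀ x u, F (diskBoundaryInclusion n x) u =
        (PF.ev (Z := Y) u).toFunP (e.toFunP ((sX.attachMap n i).toFunP x))) ∧
      ∀ x, F x 1 ∈ sY.R (n+1) := by
    intro i
    exact sY.cell_homotopy n
      (fun x => f.toFunP ((sX.incl (n+1)).toFunP ((sX.cellMap n i).toFunP x)))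
      (f.continuous_toFunP.comp ((sX.incl (n+1)).continuous_toFunP.comp
        (sX.cellMap n i).continuous_toFunP))
      (fun x u => (PF.ev (Z := Y) u).toFunP (e.toFunP ((sX.attachMap n i).toFunP x)))
      (PF.continuous_ev.comp (Continuous.prodMk (e.continuous_toFunP.comp
        ((sX.attachMap n i).continuous_toFunP.comp continuous_fst)) continuous_snd))
      (by
        intro x
        refine (FlowHom.congrP he ((sX.attachMap n i).toFunP x)).trans ?_
        exact congrArg f.toFunP (sX.incl_cell_attach n i x).symm)
      (fun x => he1 _)
  choose F h1 h2 h3 h4 using this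
  obtain ⟨e', a, b, c⟩ := sX.cellStep f n e he F h1 h2 h3
  refine ⟨e', a, b, ?_⟩
  let Γ : FlowHom (sX.sk (n+1)) Y := (PF.ev (Z := Y) (1 : unitInterval)).comp e'
  have key : ∀ x, x ∈ {x | Γ.toFunP x ∈ sY.R (n+1)} := by
    apply sX.sk_induction
    · intro x hx y hy h
      have e := Γ.comp_map x y h (Γ.composable h)
      change Γ.toFunP _ ∈ sY.R (n+1)
      rw [e]
      exact sY.R_comp (n+1) _ hx _ hy _
    · intro x
      have h := congrArg (PF.ev (Z := Y) (1 : unitInterval)).toFunP (FlowHom.congrP a x)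
      change Γ.toFunP ((sX.ι n).toFunP x) = _ at h
      change Γ.toFunP _ ∈ sY.R (n+1)
      rw [h]
      exact sY.R_mono (Nat.le_succ n) (he1 x)
    · intro i x
      have h : Γ.toFunP ((sX.cellMap n i).toFunP x) = F i x 1 := c i x 1
      change Γ.toFunP _ ∈ sY.R (n+1)
      rw [h]
      exact h4 i x
  exact key

end SCofibrantStructure

/-- cellular approximation: a morphism of flows between S-cofibrant
flows, with skeletal filtrations `(X¹ₙ)` and `(Y¹ₙ)`, is S-homotopic to a cellular
morphism `g`, i.e. one with `g(X¹ₙ) ⊆ Y¹ₙ` for every `n ≥ 0`. -/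
theorem exists_cellular_sHomotopic {X Y : Flow}
    (sX : SCofibrantStructure X) (sY : SCofibrantStructure Y) (f : FlowHom X Y) :
    ∃ g : FlowHom X Y, SHomotopy f g ∧
      ∀ n : ℕ,
        Set.range (g.comp (sX.incl n)).toFun0 ⊆ Set.range (sY.incl n).toFun0 ∧
        Set.range (g.comp (sX.incl n)).toFunP ⊆ Set.range (sY.incl n).toFunP := by
  obtain ⟨H, -, hH⟩ := sX.extend_from 0 (PF Y unitInterval)
    (fun n e => (PF.ev (Z := Y) (0 : unitInterval)).comp e = f.comp (sX.incl n) ∧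
      ∀ x, (PF.ev (Z := Y) (1 : unitInterval)).toFunP (e.toFunP x) ∈ sY.R n)
    ((PF.const Y unitInterval).comp (f.comp (sX.incl 0)))
    ⟨FlowHom.ext rfl rfl, fun x => (sX.isEmpty_path_sk_zero.false x).elim⟩
    (fun n _ e he => sX.main_step sY f n e he.1 he.2)
  refine ⟨(PF.ev (Z := Y) (1 : unitInterval)).comp H,
    ⟨fun u => (PF.ev (Z := Y) u).comp H, ?_, rfl, ?_, ?_⟩, fun n => ⟨?_, ?_⟩⟩
  · apply sX.colim_unique
    intro n
    exact (FlowHom.comp_assoc _ _ _).trans (hH n (Nat.zero_le n)).1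
  · exact PF.continuous_ev.comp
      (Continuous.prodMk (H.continuous_toFunP.comp continuous_fst) continuous_snd)
  · exact (continuous_of_discreteTopology (f := H.toFun0)).comp continuous_fst
  · intro a _
    exact sY.incl_state_surjective n a
  · rintro _ ⟨x, rfl⟩
    exact (hH n (Nat.zero_le n)).2 x


end Gaucher
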